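/- arXiv:0909.3667 — 3 statements merged into one kernel-verified Lean document; each statement's English description precedes it below -/
import Mathlib

section
/- Let {B_H(t) : t ≥ 0} be a fractional Brownian motion with Hurst parameter H ∈ (1/2, 1]. Then sup_{t ∈ [0,1]} B_H(t) ∈ W( 2, 1/2, −1, 1/√(2π) ); that is, ℙ( sup_{t ∈ [0,1]} B_H(t) > u ) = (1/√(2π)) u^{−1} exp(−u²/2) (1 + o(1)) as u → ∞. -/
open MeasureTheory ProbabilityTheory Filter Set

noncomputable section

/-- A nonnegative random variable `Y` belongs to the asymptotically Weibullian class
`W(a, b, g, c)` if `ℙ(Y > u) = c u^g exp(-b u^a) (1 + o(1))` as `u → ∞`. -/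
def MemW {Ω : Type*} [MeasurableSpace Ω] (P : Measure Ω) (Y : Ω → ℝ)
    (a b g c : ℝ) : Prop :=
  Tendsto (fun u : ℝ =>
      (P {ω | u < Y ω}).toReal / (c * u ^ g * Real.exp (-b * u ^ a)))
    atTop (nhds 1)

/-- `X` is a centered Gaussian process (indexed by nonnegative times) with covariance
function `K`. -/
def IsCenteredGaussianCov {Ω : Type*} [MeasurableSpace Ω] (P : Measure Ω)
    (X : ℝ → Ω → ℝ) (K : ℝ → ℝ → ℝ) : Prop :=
  (∀ t : ℝ, Measurable (X t)) ∧
  ∀ (n : ℕ) (t : Fin n → ℝ) (c : Fin n → ℝ), (∀ i, 0 ≤ t i) →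
    ∃ v : NNReal, ((v : ℝ) = ∑ i, ∑ j, c i * c j * K (t i) (t j)) ∧
      Measure.map (fun ω => ∑ i, c i * X (t i) ω) P = gaussianReal 0 v

/-- Covariance function of fractional Brownian motion with Hurst parameter `H`. -/
def fbmCov (H s t : ℝ) : ℝ := (s ^ (2 * H) + t ^ (2 * H) - |t - s| ^ (2 * H)) / 2

/-- `B` is a fractional Brownian motion with Hurst parameter `H` on `(Ω, P)`:
a centered Gaussian process with the fBm covariance, a.s. continuous sample paths
and `B 0 = 0` a.s. -/
def IsFBM {Ω : Type*} [MeasurableSpace Ω] (P : Measure Ω)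
    (H : ℝ) (B : ℝ → Ω → ℝ) : Prop :=
  IsCenteredGaussianCov P B (fbmCov H) ∧
  (∀ᵐ ω ∂P, ContinuousOn (fun t => B t ω) (Set.Ici 0)) ∧
  (∀ᵐ ω ∂P, B 0 ω = 0)

/-- Chernoff bound for the two-sided tail of a centered real Gaussian whose variance is at
most `w`. -/
lemma gaussianReal_sq_gt_le {v w : NNReal} (hvw : v ≤ w) {z : ℝ} (hz : 0 ≤ z) (hw : 0 < w) :
    gaussianReal 0 v {x | 2 * w * z < x ^ 2} ≤ ENNReal.ofReal (2 * Real.exp (-z)) := by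
  have hsub : HasSubgaussianMGF id w (gaussianReal 0 v) := by
    refine ⟨fun t => ?_, fun t => ?_⟩
    · simpa using integrable_exp_mul_gaussianReal (μ := 0) (v := v) t
    · rw [mgf_id_gaussianReal]
      simp only [zero_mul, zero_add]
      gcongr
  have hr : 0 ≤ √(2 * w * z) := Real.sqrt_nonneg _
  have hexp : -√(2 * w * z) ^ 2 / (2 * w) = -z := by
    rw [Real.sq_sqrt (by positivity)]
    have : (w : ℝ) ≠ 0 := by exact_mod_cast hw.ne'
    field_simp
  have h1 := hsub.measure_ge_le hr
  have h2 := hsub.neg.measure_ge_le hr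
  rw [hexp] at h1 h2
  have hincl : {x : ℝ | 2 * w * z < x ^ 2} ⊆
      {x | √(2 * w * z) ≤ id x} ∪ {x | √(2 * w * z) ≤ (-id) x} := by
    intro x hx
    have : √(2 * w * z) ≤ |x| := by
      rw [← Real.sqrt_sq_eq_abs]; exact Real.sqrt_le_sqrt (le_of_lt hx)
    rcases le_abs.1 this with h | h
    · exact Or.inl h
    · exact Or.inr h
  calc gaussianReal 0 v {x | 2 * w * z < x ^ 2}
      ≤ gaussianReal 0 v {x | √(2 * w * z) ≤ id x}
        + gaussianReal 0 v {x | √(2 * w * z) ≤ (-id) x} :=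
        (measure_mono hincl).trans (measure_union_le _ _)
    _ ≤ ENNReal.ofReal (Real.exp (-z)) + ENNReal.ofReal (Real.exp (-z)) := by
        gcongr
        · rw [← ofReal_measureReal]; exact ENNReal.ofReal_le_ofReal h1
        · rw [← ofReal_measureReal]; exact ENNReal.ofReal_le_ofReal h2
    _ = _ := by
        rw [← ENNReal.ofReal_add (Real.exp_pos _).le (Real.exp_pos _).le]; ring_nf

lemma gaussianPDFReal_zero_one (x : ℝ) :
    gaussianPDFReal 0 1 x = (√(2 * Real.pi))⁻¹ * Real.exp (-x ^ 2 / 2) := by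
  simp [gaussianPDFReal]

/-- The standard Gaussian density lies below its exponential tangent at `u`. -/
lemma gaussianPDFReal_le_mul_exp (u x : ℝ) :
    gaussianPDFReal 0 1 x ≤ gaussianPDFReal 0 1 u * Real.exp (u * (u - x)) := by
  rw [gaussianPDFReal_zero_one, gaussianPDFReal_zero_one, mul_assoc, ← Real.exp_add]
  gcongr
  nlinarith [sq_nonneg (x - u)]

lemma lintegral_exp_mul_Iic {c : ℝ} (hc : 0 < c) {A : ℝ} (hA : 0 ≤ A) (b d : ℝ) :
    ∫⁻ x in Iic d, ENNReal.ofReal (A * Real.exp (c * (x - b))) =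
      ENNReal.ofReal (A * Real.exp (c * (d - b)) / c) := by
  have e : ∀ x, A * Real.exp (c * (x - b)) = A * Real.exp (-(c * b)) * Real.exp (c * x) := by
    intro x; rw [mul_assoc, ← Real.exp_add]; ring_nf
  simp_rw [e]
  rw [← ofReal_integral_eq_lintegral_ofReal]
  · rw [integral_const_mul, integral_exp_mul_Iic hc]; ring_nf
  · exact (integrableOn_exp_mul_Iic hc d).const_mul _
  · exact Eventually.of_forall fun x => by positivity

/-- Upper Mills bound for the standard Gaussian tail. -/
lemma gaussianReal_Ici_le {u : ℝ} (hu : 0 < u) :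
    gaussianReal 0 1 (Ici u) ≤ ENNReal.ofReal (gaussianPDFReal 0 1 u / u) := by
  have hneg : gaussianReal 0 1 (Ici u) = gaussianReal 0 1 (Iic (-u)) := by
    conv_lhs => rw [← neg_zero, ← gaussianReal_map_neg]
    rw [Measure.map_apply (by fun_prop) measurableSet_Ici]
    congr 1; ext x; simp
  rw [hneg, gaussianReal_apply _ one_ne_zero]
  calc ∫⁻ x in Iic (-u), gaussianPDF 0 1 x
      ≤ ∫⁻ x in Iic (-u), ENNReal.ofReal (gaussianPDFReal 0 1 u * Real.exp (u * (x - (-u)))) := by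
        refine lintegral_mono fun x => ENNReal.ofReal_le_ofReal ?_
        have := gaussianPDFReal_le_mul_exp (-u) x
        have e : gaussianPDFReal 0 1 (-u) = gaussianPDFReal 0 1 u := by
          simp [gaussianPDFReal_zero_one]
        rw [e] at this
        convert this using 3; ring
    _ = _ := by
        rw [lintegral_exp_mul_Iic hu (gaussianPDFReal_nonneg _ _ _)]; simp

/-- Lower Mills bound for the standard Gaussian tail. -/
lemma le_gaussianReal_Ioi (u : ℝ) :
    gaussianPDFReal 0 1 u * (u / (1 + u ^ 2)) ≤ (gaussianReal 0 1).real (Ioi u) := by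
  have hφ : ∀ x, HasDerivAt (gaussianPDFReal 0 1) (gaussianPDFReal 0 1 x * -x) x := by
    intro x
    have h : HasDerivAt (fun x : ℝ => (√(2 * Real.pi))⁻¹ * Real.exp (-x ^ 2 / 2))
        ((√(2 * Real.pi))⁻¹ * (Real.exp (-x ^ 2 / 2) * (-(2 * x) / 2))) x := by
      refine HasDerivAt.const_mul _ (HasDerivAt.exp ?_)
      simpa using ((hasDerivAt_pow 2 x).neg.div_const 2)
    rw [funext gaussianPDFReal_zero_one]
    convert h using 1; ring
  have hder : ∀ x, HasDerivAt (fun x => -(gaussianPDFReal 0 1 x * (x / (1 + x ^ 2))))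
      (gaussianPDFReal 0 1 x * (1 - 2 / (1 + x ^ 2) ^ 2)) x := by
    intro x
    have hx : 1 + x ^ 2 ≠ 0 := by positivity
    have h2 : HasDerivAt (fun x : ℝ => 1 + x ^ 2) (2 * x) x := by
      simpa using (hasDerivAt_pow 2 x).const_add 1
    refine ((hφ x).mul ((hasDerivAt_id' x).div h2 hx)).neg.congr_deriv ?_
    simp only [Pi.div_apply]
    field_simp
    ring
  have hbound : ∀ x : ℝ, 1 - 2 / (1 + x ^ 2) ^ 2 ≤ 1 := fun x => by
    have : 0 ≤ 2 / (1 + x ^ 2) ^ 2 := by positivity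
    linarith
  have hint : Integrable (fun x => gaussianPDFReal 0 1 x * (1 - 2 / (1 + x ^ 2) ^ 2)) := by
    refine (integrable_gaussianPDFReal 0 1).mul_bdd (c := 1)
      (by fun_prop : Measurable fun x : ℝ => 1 - 2 / (1 + x ^ 2) ^ 2).aestronglyMeasurable
      (Eventually.of_forall fun x => ?_)
    rw [Real.norm_eq_abs, abs_le]
    refine ⟨?_, hbound x⟩
    have : 2 / (1 + x ^ 2) ^ 2 ≤ 2 := by
      rw [div_le_iff₀ (by positivity)]; nlinarith [sq_nonneg x, sq_nonneg (x ^ 2)]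
    linarith
  have hlim : Tendsto (fun x => -(gaussianPDFReal 0 1 x * (x / (1 + x ^ 2)))) atTop (nhds 0) := by
    have hle1 : ∀ x, gaussianPDFReal 0 1 x ≤ 1 := by
      intro x
      rw [gaussianPDFReal_zero_one]
      refine mul_le_one₀ (inv_le_one_of_one_le₀ ?_) (Real.exp_pos _).le
        (Real.exp_le_one_iff.2 (by nlinarith [sq_nonneg x]))
      rw [Real.one_le_sqrt]; linarith [Real.pi_gt_three]
    rw [show nhds (0 : ℝ) = nhds (-0) by simp]
    refine Tendsto.neg (squeeze_zero' (g := fun x : ℝ => x⁻¹) ?_ ?_ tendsto_inv_atTop_zero)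
    · filter_upwards [eventually_gt_atTop 0] with x hx
      exact mul_nonneg (gaussianPDFReal_nonneg _ _ _) (by positivity)
    · filter_upwards [eventually_gt_atTop 0] with x hx
      calc gaussianPDFReal 0 1 x * (x / (1 + x ^ 2)) ≤ 1 * (x / (x ^ 2)) := by
            gcongr
            · exact hle1 x
            · linarith
        _ = x⁻¹ := by field_simp
  have hI := integral_Ioi_of_hasDerivAt_of_tendsto' (a := u) (fun x _ => hder x)
    hint.integrableOn hlim
  have : (gaussianReal 0 1).real (Ioi u) = ∫ x in Ioi u, gaussianPDFReal 0 1 x := by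
    rw [measureReal_def, gaussianReal_apply_eq_integral _ one_ne_zero, ENNReal.toReal_ofReal]
    exact integral_nonneg fun x => gaussianPDFReal_nonneg _ _ _
  rw [this]
  calc gaussianPDFReal 0 1 u * (u / (1 + u ^ 2))
      = ∫ x in Ioi u, gaussianPDFReal 0 1 x * (1 - 2 / (1 + x ^ 2) ^ 2) := by
        rw [hI]; ring
    _ ≤ _ := by
        refine integral_mono hint.integrableOn (integrable_gaussianPDFReal 0 1).integrableOn
          fun x => ?_
        exact mul_le_of_le_one_right (gaussianPDFReal_nonneg _ _ _) (hbound x)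

/-- Joint tail estimate for a standard Gaussian `X` close to `u` from below and an independent
centered Gaussian `Z`. -/
lemma measure_lt_and_sq_gt_le {Ω : Type*} [MeasurableSpace Ω] {P : Measure Ω}
    [IsProbabilityMeasure P] {X Z : Ω → ℝ} (hXm : Measurable X) (hZm : Measurable Z)
    (hXZ : IndepFun X Z P) (hX : P.map X = gaussianReal 0 1) {v w : NNReal}
    (hZ : P.map Z = gaussianReal 0 v) (hvw : v ≤ w) (hw : 0 < w) {u a L : ℝ} (hu : 0 < u)
    (ha : 0 < a) (hL : 1 < L) :
    P {ω | X ω < u - a / u ∧ 2 * w * (L * (u * (u - X ω))) < Z ω ^ 2} ≤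
      ENNReal.ofReal (2 * gaussianPDFReal 0 1 u * Real.exp (-((L - 1) * a)) / ((L - 1) * u)) := by
  set S : Set (ℝ × ℝ) := {p | p.1 < u - a / u ∧ 2 * w * (L * (u * (u - p.1))) < p.2 ^ 2} with hS
  have hSm : MeasurableSet S := by
    rw [hS, ofPred_and]
    exact (measurableSet_lt (by fun_prop) (by fun_prop)).inter
      (measurableSet_lt (by fun_prop) (by fun_prop))
  have h1 : P {ω | X ω < u - a / u ∧ 2 * w * (L * (u * (u - X ω))) < Z ω ^ 2} =
      ((gaussianReal 0 1).prod (gaussianReal 0 v)) S := by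
    rw [← hX, ← hZ, ← (indepFun_iff_map_prod_eq_prod_map_map hXm.aemeasurable
      hZm.aemeasurable).1 hXZ, Measure.map_apply (by fun_prop) hSm]
    rfl
  rw [h1, Measure.prod_apply hSm]
  have hau : 0 < a / u := by positivity
  calc ∫⁻ x, gaussianReal 0 v (Prod.mk x ⁻¹' S) ∂(gaussianReal 0 1)
      ≤ ∫⁻ x, (Iic (u - a / u)).indicator
          (fun x => ENNReal.ofReal (2 * Real.exp (-(L * (u * (u - x)))))) x ∂(gaussianReal 0 1) := by
        refine lintegral_mono fun x => ?_
        by_cases hx : x < u - a / u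
        · rw [indicator_of_mem (show x ∈ Iic (u - a / u) from hx.le)]
          have hux : 0 < u - x := by linarith
          refine le_trans (measure_mono ?_)
            (gaussianReal_sq_gt_le hvw (z := L * (u * (u - x))) (by positivity) hw)
          intro y hy
          exact hy.2
        · have : Prod.mk x ⁻¹' S = ∅ := by
            ext y; simp [hS, hx]
          simp [this]
    _ = ∫⁻ x in Iic (u - a / u), gaussianPDF 0 1 x *
          ENNReal.ofReal (2 * Real.exp (-(L * (u * (u - x))))) := by
        rw [lintegral_indicator measurableSet_Iic, gaussianReal_of_var_ne_zero _ one_ne_zero,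
          setLIntegral_withDensity_eq_setLIntegral_mul _ (measurable_gaussianPDF 0 1)
          (by fun_prop) measurableSet_Iic]
        rfl
    _ ≤ ∫⁻ x in Iic (u - a / u), ENNReal.ofReal
          (2 * gaussianPDFReal 0 1 u * Real.exp (((L - 1) * u) * (x - u))) := by
        refine lintegral_mono fun x => ?_
        rw [gaussianPDF, ← ENNReal.ofReal_mul (gaussianPDFReal_nonneg _ _ _)]
        refine ENNReal.ofReal_le_ofReal ?_
        calc gaussianPDFReal 0 1 x * (2 * Real.exp (-(L * (u * (u - x)))))
            ≤ gaussianPDFReal 0 1 u * Real.exp (u * (u - x)) *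
              (2 * Real.exp (-(L * (u * (u - x))))) := by
              gcongr; exact gaussianPDFReal_le_mul_exp u x
          _ = 2 * gaussianPDFReal 0 1 u *
              (Real.exp (u * (u - x)) * Real.exp (-(L * (u * (u - x))))) := by ring
          _ = _ := by rw [← Real.exp_add]; ring_nf
    _ = _ := by
        have hL' : 0 < L - 1 := by linarith
        have := gaussianPDFReal_nonneg 0 1 u
        rw [lintegral_exp_mul_Iic (by positivity) (by positivity)]
        congr 4
        field_simp
        ring

/-- If all level-`n` dyadic increments of a continuous `f` are at most `m * q ^ n`, then `f` is
geometrically well approximated by its values at dyadic points. -/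
lemma abs_sub_dyadic_floor_le {f : ℝ → ℝ} (hf : ContinuousOn f (Icc 0 1)) {m q : ℝ}
    (hm : 0 ≤ m) (hq0 : 0 ≤ q) (hq : q ≤ 3 / 4)
    (hinc : ∀ n k : ℕ, k < 2 ^ n → |f ((k + 1) / 2 ^ n) - f (k / 2 ^ n)| ≤ m * q ^ n)
    {t : ℝ} (ht : t ∈ Ico (0 : ℝ) 1) (p : ℕ) :
    |f t - f (⌊t * 2 ^ p⌋₊ / 2 ^ p)| ≤ 3 * m * q ^ p := by
  have hpow : ∀ n : ℕ, (0 : ℝ) < 2 ^ n := fun n => by positivity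
  have hstep : ∀ n : ℕ, dist (f (⌊t * 2 ^ n⌋₊ / 2 ^ n)) (f (⌊t * 2 ^ (n + 1)⌋₊ / 2 ^ (n + 1))) ≤
      m * q * q ^ n := by
    intro n
    have h0 : 0 ≤ t * 2 ^ n := mul_nonneg ht.1 (hpow n).le
    have hk := Nat.floor_le h0
    have hk' := Nat.lt_floor_add_one (t * 2 ^ n)
    have hlt : ⌊t * 2 ^ n⌋₊ < 2 ^ n := by
      rw [Nat.floor_lt h0]; push_cast
      nlinarith [hpow n, ht.2]
    set k := ⌊t * 2 ^ n⌋₊ with hkdef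
    have hcases : ⌊t * 2 ^ (n + 1)⌋₊ = 2 * k ∨ ⌊t * 2 ^ (n + 1)⌋₊ = 2 * k + 1 := by
      have h1 : 2 * k ≤ ⌊t * 2 ^ (n + 1)⌋₊ := by
        apply Nat.le_floor; push_cast; rw [pow_succ]; linarith
      have h2 : ⌊t * 2 ^ (n + 1)⌋₊ < 2 * k + 2 := by
        rw [Nat.floor_lt (mul_nonneg ht.1 (hpow _).le)]; push_cast; rw [pow_succ]; linarith
      omega
    have heq : (k : ℝ) / 2 ^ n = ((2 * k : ℕ) : ℝ) / 2 ^ (n + 1) := by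
      rw [pow_succ]; push_cast; field_simp
    rcases hcases with h | h
    · rw [h, heq, dist_self]; positivity
    · rw [h, heq, dist_comm, Real.dist_eq]
      have := hinc (n + 1) (2 * k) (by rw [pow_succ]; omega)
      calc _ = |f (((2 * k : ℕ) + 1) / 2 ^ (n + 1)) - f ((2 * k : ℕ) / 2 ^ (n + 1))| := by
            push_cast; rfl
        _ ≤ _ := this
        _ = _ := by ring
  have hlim : Tendsto (fun n : ℕ => f (⌊t * 2 ^ n⌋₊ / 2 ^ n)) atTop (nhds (f t)) := by
    have h1 : Tendsto (fun n : ℕ => (⌊t * 2 ^ n⌋₊ : ℝ) / 2 ^ n) atTop (nhds t) :=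
      (tendsto_nat_floor_mul_div_atTop ht.1).comp
        (tendsto_pow_atTop_atTop_of_one_lt (one_lt_two : (1 : ℝ) < 2))
    have h2 : Tendsto (fun n : ℕ => (⌊t * 2 ^ n⌋₊ : ℝ) / 2 ^ n) atTop (nhdsWithin t (Icc 0 1)) := by
      refine tendsto_nhdsWithin_iff.2 ⟨h1, Eventually.of_forall fun n => ⟨by positivity, ?_⟩⟩
      rw [div_le_one (hpow n)]
      have := Nat.floor_le (mul_nonneg ht.1 (hpow n).le)
      nlinarith [hpow n, ht.2]
    exact (hf t ⟨ht.1, ht.2.le⟩).tendsto.comp h2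
  have hd := dist_le_of_le_geometric_of_tendsto q (m * q) (by linarith) hstep hlim p
  rw [abs_sub_comm, ← Real.dist_eq]
  refine hd.trans ?_
  rw [div_le_iff₀ (by linarith)]
  have : 0 ≤ m * q ^ p := by positivity
  nlinarith

/-- Dyadic increment bounds give a Hölder bound at the right end point. -/
lemma abs_sub_one_le_of_dyadic {f : ℝ → ℝ} (hf : ContinuousOn f (Icc 0 1)) {m γ : ℝ}
    (hm : 0 ≤ m) (hγ : 1 / 2 ≤ γ)
    (hinc : ∀ n k : ℕ, k < 2 ^ n →
      |f ((k + 1) / 2 ^ n) - f (k / 2 ^ n)| ≤ m * ((1 / 2 : ℝ) ^ γ) ^ n)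
    {t : ℝ} (ht : t ∈ Ico (0 : ℝ) 1) :
    |f t - f 1| ≤ 5 * m * (1 - t) ^ γ := by
  set q : ℝ := (1 / 2 : ℝ) ^ γ with hq
  have hq0 : 0 < q := by positivity
  have hq1 : q ≤ 3 / 4 := by
    calc q ≤ (1 / 2 : ℝ) ^ (1 / 2 : ℝ) :=
          Real.rpow_le_rpow_of_exponent_ge (by norm_num) (by norm_num) hγ
      _ ≤ 3 / 4 := by
          rw [← Real.sqrt_eq_rpow, Real.sqrt_le_left (by norm_num)]; norm_num
  obtain ⟨n, hn1, hn2⟩ := exists_nat_pow_near_of_lt_one (x := 1 - t) (y := 1 / 2)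
    (by linarith [ht.2]) (by linarith [ht.1]) (by norm_num) (by norm_num)
  have h2n : (0 : ℝ) < 2 ^ n := by positivity
  have e1 : (1 / 2 : ℝ) ^ (n + 1) * 2 ^ (n + 1) = 1 := by rw [← mul_pow]; norm_num
  have hN : ∃ N : ℕ, 2 ^ (n + 1) = N + 2 :=
    ⟨2 ^ (n + 1) - 2, by have := Nat.one_le_two_pow (n := n); rw [pow_succ]; omega⟩
  obtain ⟨N, hN⟩ := hN
  have hNR : (2 : ℝ) ^ (n + 1) = N + 2 := by exact_mod_cast hN
  have e2 : (1 / 2 : ℝ) ^ n = 2 * (1 / 2) ^ (n + 1) := by rw [pow_succ]; ring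
  have hfl : ⌊t * 2 ^ (n + 1)⌋₊ = N := by
    rw [Nat.floor_eq_iff (mul_nonneg ht.1 (by positivity))]
    have hp : (0 : ℝ) < 2 ^ (n + 1) := by positivity
    have a1 : (1 - t) * 2 ^ (n + 1) ≤ 2 := by
      calc (1 - t) * 2 ^ (n + 1) ≤ (2 * (1 / 2) ^ (n + 1)) * 2 ^ (n + 1) := by
            gcongr; rw [← e2]; exact hn2
        _ = 2 := by rw [mul_assoc, e1]; norm_num
    have a2 : 1 < (1 - t) * 2 ^ (n + 1) := by
      have := mul_lt_mul_of_pos_right hn1 hp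
      rwa [e1] at this
    constructor <;> linarith
  have h1 := abs_sub_dyadic_floor_le hf hm hq0.le hq1 hinc ht (n + 1)
  rw [hfl] at h1
  have h2 := hinc (n + 1) N (by omega)
  have h3 := hinc (n + 1) (N + 1) (by omega)
  have e3 : (((N + 1 : ℕ) : ℝ) + 1) / 2 ^ (n + 1) = 1 := by
    rw [hNR]; push_cast; rw [div_eq_one_iff_eq (by positivity)]; ring
  rw [e3] at h3
  push_cast at h3
  have hqn : q ^ (n + 1) ≤ (1 - t) ^ γ := by
    rw [hq, ← Real.rpow_natCast, ← Real.rpow_mul (by norm_num), mul_comm,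
      Real.rpow_mul (by norm_num), Real.rpow_natCast]
    exact Real.rpow_le_rpow (by positivity) hn1.le (by linarith)
  have h4 : |f t - f 1| ≤ 5 * m * q ^ (n + 1) := by
    rw [abs_le] at *
    constructor <;> linarith [h1.1, h1.2, h2.1, h2.2, h3.1, h3.2]
  exact h4.trans (by gcongr)

lemma measure_exists_dyadic_le {Ω : Type*} [MeasurableSpace Ω] (P : Measure Ω)
    (E : ℕ → ℕ → Set Ω) (c : ℕ → ENNReal) (h : ∀ n k, k < 2 ^ n → P (E n k) ≤ c n) :
    P {ω | ∃ n k, k < 2 ^ n ∧ ω ∈ E n k} ≤ ∑' n, 2 ^ n * c n := by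
  have : {ω | ∃ n k, k < 2 ^ n ∧ ω ∈ E n k} = ⋃ n, ⋃ k ∈ Finset.range (2 ^ n), E n k := by
    ext ω; simp
  rw [this]
  refine (measure_iUnion_le _).trans (ENNReal.tsum_le_tsum fun n => ?_)
  refine (measure_biUnion_finset_le _ _).trans ?_
  calc ∑ k ∈ Finset.range (2 ^ n), P (E n k) ≤ ∑ _k ∈ Finset.range (2 ^ n), c n :=
        Finset.sum_le_sum fun k hk => h n k (Finset.mem_range.1 hk)
    _ = 2 ^ n * c n := by simp

/-- Total mass of the Gaussian tails of all dyadic increments. -/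
def dyadicTailSum (R x : ℝ) : ENNReal := ∑' n : ℕ, 2 ^ n * ENNReal.ofReal (2 * Real.exp (-(x * R ^ n)))

lemma dyadicTailSum_le {R : ℝ} (hR : 1 < R) :
    ∃ C : ℝ, 0 ≤ C ∧ ∀ x, 1 ≤ x → dyadicTailSum R x ≤ ENNReal.ofReal (C * Real.exp (-(x / 2))) := by
  set F : ℕ → ℝ := fun n => 2 ^ n * (2 * Real.exp (-(R ^ n / 2))) with hF
  have hFpos : ∀ n, 0 < F n := fun n => by positivity
  have hsum : Summable F := by
    refine summable_of_ratio_test_tendsto_lt_one (l := 0) one_pos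
      (Eventually.of_forall fun n => (hFpos n).ne') ?_
    have e : ∀ n, ‖F (n + 1)‖ / ‖F n‖ = 2 * Real.exp (-(R ^ n * ((R - 1) / 2))) := by
      intro n
      rw [Real.norm_of_nonneg (hFpos _).le, Real.norm_of_nonneg (hFpos _).le,
        div_eq_iff (hFpos n).ne', hF]
      have : Real.exp (-(R ^ (n + 1) / 2)) =
          Real.exp (-(R ^ n * ((R - 1) / 2))) * Real.exp (-(R ^ n / 2)) := by
        rw [← Real.exp_add]; ring_nf
      simp only
      rw [this, pow_succ 2]; ring
    simp_rw [e]
    rw [← mul_zero (2 : ℝ)]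
    refine Tendsto.const_mul _ (Real.tendsto_exp_neg_atTop_nhds_zero.comp ?_)
    exact (tendsto_pow_atTop_atTop_of_one_lt hR).atTop_mul_const (by linarith)
  refine ⟨∑' n, F n, tsum_nonneg fun n => (hFpos n).le, fun x hx => ?_⟩
  rw [← tsum_mul_right, ENNReal.ofReal_tsum_of_nonneg (fun n => by have := hFpos n; positivity)
    (hsum.mul_right _)]
  refine ENNReal.tsum_le_tsum fun n => ?_
  have h2 : (2 : ENNReal) ^ n = ENNReal.ofReal (2 ^ n) := by
    rw [ENNReal.ofReal_pow (by norm_num)]; simp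
  rw [h2, ← ENNReal.ofReal_mul (by positivity)]
  refine ENNReal.ofReal_le_ofReal ?_
  rw [hF]
  simp only
  rw [mul_assoc (2 ^ n), mul_assoc (2 : ℝ), ← Real.exp_add]
  gcongr
  have : 1 ≤ R ^ n := one_le_pow₀ hR.le
  nlinarith

/-- Two centered random variables whose linear combinations are all Gaussian with diagonal
variance are independent. -/
lemma indepFun_of_map_linear_combination {Ω : Type*} [MeasurableSpace Ω] {P : Measure Ω}
    [IsProbabilityMeasure P] {X Z : Ω → ℝ} (hX : Measurable X) (hZ : Measurable Z) {d e : ℝ}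
    (h : ∀ a b : ℝ, ∃ v : NNReal, (v : ℝ) = a ^ 2 * d + b ^ 2 * e ∧
      P.map (fun ω => a * X ω + b * Z ω) = gaussianReal 0 v) : IndepFun X Z P := by
  have key : ∀ a b : ℝ, charFun (P.map (fun ω => a * X ω + b * Z ω)) 1 =
      Complex.exp (-((a ^ 2 * d + b ^ 2 * e : ℝ) : ℂ) / 2) := by
    intro a b
    obtain ⟨v, hv, hm⟩ := h a b
    rw [hm, charFun_gaussianReal, ← hv]
    simp
    ring_nf
  rw [indepFun_iff_charFunDual_prod hX.aemeasurable hZ.aemeasurable]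
  intro L
  have hL : ∀ x z : ℝ, L (x, z) = L (1, 0) * x + L (0, 1) * z := by
    intro x z
    have : ((x, z) : ℝ × ℝ) = x • (1, 0) + z • (0, 1) := by simp
    rw [this, map_add, map_smul, map_smul]; simp [mul_comm]
  have e1 : (P.map fun ω => (X ω, Z ω)).map L =
      P.map (fun ω => L (1, 0) * X ω + L (0, 1) * Z ω) := by
    rw [Measure.map_map (by fun_prop) (by fun_prop)]
    congr 1; ext ω; exact hL _ _
  have e2 : (P.map X).map (L.comp (.inl ℝ ℝ ℝ)) =
      P.map (fun ω => L (1, 0) * X ω + 0 * Z ω) := by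
    rw [Measure.map_map (by fun_prop) (by fun_prop)]
    congr 1; ext ω; simp [hL (X ω) 0]
  have e3 : (P.map Z).map (L.comp (.inr ℝ ℝ ℝ)) =
      P.map (fun ω => 0 * X ω + L (0, 1) * Z ω) := by
    rw [Measure.map_map (by fun_prop) (by fun_prop)]
    congr 1; ext ω; simp [hL 0 (Z ω)]
  rw [charFunDual_eq_charFun_map_one, charFunDual_eq_charFun_map_one,
    charFunDual_eq_charFun_map_one, e1, e2, e3, key, key, key, ← Complex.exp_add]
  congr 1
  push_cast
  ring

section FBM

variable {Ω : Type*} [MeasurableSpace Ω] {P : Measure Ω} {H : ℝ} {B : ℝ → Ω → ℝ}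

lemma fbmCov_self (hH : 0 < H) (t : ℝ) : fbmCov H t t = t ^ (2 * H) := by
  simp [fbmCov, Real.zero_rpow (by positivity : 2 * H ≠ 0)]

lemma fbmCov_comm (s t : ℝ) : fbmCov H s t = fbmCov H t s := by
  rw [fbmCov, fbmCov, abs_sub_comm]; ring

lemma fbmCov_one_one (hH : 0 < H) : fbmCov H 1 1 = 1 := by simp [fbmCov_self hH]

lemma map_fbm (hB : IsCenteredGaussianCov P B (fbmCov H)) (hH : 0 < H) {t : ℝ} (ht : 0 ≤ t) :
    ∃ v : NNReal, (v : ℝ) = t ^ (2 * H) ∧ P.map (B t) = gaussianReal 0 v := by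
  obtain ⟨v, hv, hm⟩ := hB.2 1 ![t] ![1] (by simpa using ht)
  refine ⟨v, by simpa [fbmCov_self hH] using hv, by simpa using hm⟩

lemma map_fbm_sub (hB : IsCenteredGaussianCov P B (fbmCov H)) (hH : 0 < H) {s t : ℝ} (hs : 0 ≤ s)
    (ht : 0 ≤ t) : ∃ v : NNReal, (v : ℝ) = |s - t| ^ (2 * H) ∧
      P.map (fun ω => B s ω - B t ω) = gaussianReal 0 v := by
  obtain ⟨v, hv, hm⟩ := hB.2 2 ![s, t] ![1, -1] (by
    intro i; fin_cases i <;> simpa)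
  refine ⟨v, ?_, by simpa [Fin.sum_univ_two, ← sub_eq_add_neg] using hm⟩
  rw [hv]
  simp [Fin.sum_univ_two, fbmCov_self hH, fbmCov_comm t s]
  rw [fbmCov, abs_sub_comm]; ring

/-- The residual of fractional Brownian motion after projecting on its value at time one. -/
def fbmResidual (H : ℝ) (B : ℝ → Ω → ℝ) (t : ℝ) (ω : Ω) : ℝ := B t ω - fbmCov H t 1 * B 1 ω

lemma map_fbm_one_add_residual_sub (hB : IsCenteredGaussianCov P B (fbmCov H)) (hH : 0 < H)
    {s t : ℝ} (hs : 0 ≤ s) (ht : 0 ≤ t) (a b : ℝ) :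
    ∃ v : NNReal,
      (v : ℝ) = a ^ 2 * 1 + b ^ 2 * (|s - t| ^ (2 * H) - (fbmCov H s 1 - fbmCov H t 1) ^ 2) ∧
      P.map (fun ω => a * B 1 ω + b * (fbmResidual H B s ω - fbmResidual H B t ω)) =
        gaussianReal 0 v := by
  obtain ⟨v, hv, hm⟩ := hB.2 3 ![s, t, 1] ![b, -b, a - b * (fbmCov H s 1 - fbmCov H t 1)] (by
    intro i; fin_cases i <;> simp [hs, ht])
  refine ⟨v, ?_, ?_⟩
  · rw [hv]
    have h1 : |s - t| ^ (2 * H) = fbmCov H s s + fbmCov H t t - 2 * fbmCov H s t := by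
      rw [fbmCov_self hH, fbmCov_self hH, fbmCov, abs_sub_comm]; ring
    rw [h1]
    simp only [Fin.sum_univ_three, Matrix.cons_val_zero, Matrix.cons_val_one, Matrix.cons_val]
    rw [fbmCov_one_one hH, fbmCov_comm t s, fbmCov_comm 1 s, fbmCov_comm 1 t]
    ring
  · rw [← hm]
    congr 1; ext ω
    simp only [Fin.sum_univ_three, Matrix.cons_val_zero, Matrix.cons_val_one, Matrix.cons_val,
      fbmResidual]
    ring

lemma map_fbm_one (hB : IsCenteredGaussianCov P B (fbmCov H)) (hH : 0 < H) :
    P.map (B 1) = gaussianReal 0 1 := by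
  obtain ⟨v, hv, hm⟩ := map_fbm hB hH zero_le_one
  rw [hm]; congr; ext; simpa using hv

lemma measurable_fbmResidual (hB : IsCenteredGaussianCov P B (fbmCov H)) (t : ℝ) :
    Measurable (fbmResidual H B t) :=
  (hB.1 t).sub ((hB.1 1).const_mul _)

lemma map_fbmResidual_sub (hB : IsCenteredGaussianCov P B (fbmCov H)) (hH : 0 < H) {s t : ℝ}
    (hs : 0 ≤ s) (ht : 0 ≤ t) : ∃ v : NNReal, (v : ℝ) ≤ |s - t| ^ (2 * H) ∧
      P.map (fun ω => fbmResidual H B s ω - fbmResidual H B t ω) = gaussianReal 0 v := by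
  obtain ⟨v, hv, hm⟩ := map_fbm_one_add_residual_sub hB hH hs ht 0 1
  refine ⟨v, ?_, by simpa using hm⟩
  rw [hv]; nlinarith [sq_nonneg (fbmCov H s 1 - fbmCov H t 1)]

lemma indepFun_fbm_one_residual_sub [IsProbabilityMeasure P]
    (hB : IsCenteredGaussianCov P B (fbmCov H)) (hH : 0 < H) {s t : ℝ}
    (hs : 0 ≤ s) (ht : 0 ≤ t) :
    IndepFun (B 1) (fun ω => fbmResidual H B s ω - fbmResidual H B t ω) P :=
  indepFun_of_map_linear_combination (hB.1 1)
    ((measurable_fbmResidual hB s).sub (measurable_fbmResidual hB t))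
    (map_fbm_one_add_residual_sub hB hH hs ht)

lemma fbmCov_one_le (hH : 1 / 2 ≤ H) {t : ℝ} (ht : t ∈ Icc (0 : ℝ) 1) :
    fbmCov H t 1 ≤ (1 + t) / 2 := by
  have h1 : t ^ (2 * H) ≤ t := by
    simpa using Real.rpow_le_rpow_of_exponent_ge' ht.1 ht.2 zero_le_one (by linarith : 1 ≤ 2 * H)
  have h2 : 0 ≤ |1 - t| ^ (2 * H) := by positivity
  rw [fbmCov, Real.one_rpow]; linarith

lemma le_fbmCov_one (hH : 1 / 2 ≤ H) {t : ℝ} (ht : t ∈ Icc (0 : ℝ) 1) :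
    t / 2 ≤ fbmCov H t 1 := by
  have h1 : |1 - t| ^ (2 * H) ≤ 1 - t := by
    rw [abs_of_nonneg (by linarith [ht.2])]
    simpa using Real.rpow_le_rpow_of_exponent_ge' (sub_nonneg.2 ht.2) (by linarith [ht.1])
      zero_le_one (by linarith : 1 ≤ 2 * H)
  have h2 : 0 ≤ t ^ (2 * H) := Real.rpow_nonneg ht.1 _
  rw [fbmCov, Real.one_rpow]; linarith

lemma continuous_fbmCov_one (hH : 0 ≤ H) : Continuous fun t => fbmCov H t 1 := by
  unfold fbmCov
  have h : 0 ≤ 2 * H := by positivity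
  exact (((Real.continuous_rpow_const h).add continuous_const).sub
    ((Real.continuous_rpow_const h).comp (by fun_prop : Continuous fun t : ℝ => |1 - t|))).div_const _

end FBM

section Dyadic

variable {Ω : Type*} [MeasurableSpace Ω] {P : Measure Ω}

/-- Union bound for the dyadic increments of a process with Gaussian increments. -/
lemma measure_exists_dyadic_increment_gt_le {Z : ℝ → Ω → ℝ} (hZm : ∀ t, Measurable (Z t))
    {w : NNReal} (hw : 0 < w) {R q : ℝ} (hR : 0 ≤ R) (hq : 0 ≤ q) (hwR : w * R = q ^ 2)
    (hZ : ∀ n k : ℕ, k < 2 ^ n → ∃ v : NNReal, v ≤ w ^ n ∧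
      P.map (fun ω => Z ((k + 1) / 2 ^ n) ω - Z (k / 2 ^ n) ω) = gaussianReal 0 v)
    {m : ℝ} (hm : 0 ≤ m) :
    P {ω | ∃ n k : ℕ, k < 2 ^ n ∧ m * q ^ n < |Z ((k + 1) / 2 ^ n) ω - Z (k / 2 ^ n) ω|} ≤
      dyadicTailSum R (m ^ 2 / 2) := by
  refine measure_exists_dyadic_le P
    (fun n k => {ω | m * q ^ n < |Z ((k + 1) / 2 ^ n) ω - Z (k / 2 ^ n) ω|}) _ fun n k hk => ?_
  obtain ⟨v, hv, hmap⟩ := hZ n k hk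
  have h := gaussianReal_sq_gt_le hv (z := m ^ 2 / 2 * R ^ n) (by positivity) (by positivity)
  have hmeas : Measurable fun ω => Z ((k + 1) / 2 ^ n) ω - Z (k / 2 ^ n) ω := (hZm _).sub (hZm _)
  rw [← hmap, Measure.map_apply hmeas
    (measurableSet_lt (by fun_prop) (by fun_prop))] at h
  refine (measure_mono fun ω hω => ?_).trans h
  have e : 2 * ((w ^ n : NNReal) : ℝ) * (m ^ 2 / 2 * R ^ n) = (m * q ^ n) ^ 2 := by
    calc _ = m ^ 2 * ((w : ℝ) * R) ^ n := by push_cast; rw [mul_pow]; ring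
      _ = _ := by rw [hwR]; ring
  simp only [mem_preimage, mem_ofPred_eq] at hω ⊢
  rw [e]
  exact sq_lt_sq.2 (by rwa [abs_of_nonneg (by positivity)])

/-- Union bound for the dyadic increments of a process independent of the standard Gaussian
variable `X`, on the event that `X` lies below the level `u`. -/
lemma measure_lt_and_exists_dyadic_increment_gt_le [IsProbabilityMeasure P] {X : Ω → ℝ} {Z : ℝ → Ω → ℝ}
    (hXm : Measurable X) (hZm : ∀ t, Measurable (Z t)) (hX : P.map X = gaussianReal 0 1)
    {w : NNReal} (hw : 0 < w) {R q : ℝ} (hR : 1 ≤ R) (hwR : w * R = q ^ 2)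
    (hZ : ∀ n k : ℕ, k < 2 ^ n → ∃ v : NNReal, v ≤ w ^ n ∧
      P.map (fun ω => Z ((k + 1) / 2 ^ n) ω - Z (k / 2 ^ n) ω) = gaussianReal 0 v)
    (hXZ : ∀ n k : ℕ, k < 2 ^ n →
      IndepFun X (fun ω => Z ((k + 1) / 2 ^ n) ω - Z (k / 2 ^ n) ω) P)
    {u a K : ℝ} (hu : 0 < u) (ha : 0 < a) (hK : 4 ≤ K) :
    P {ω | ∃ n k : ℕ, k < 2 ^ n ∧ X ω < u - a / u ∧
        K * (u * (u - X ω)) * (q ^ n) ^ 2 < (Z ((k + 1) / 2 ^ n) ω - Z (k / 2 ^ n) ω) ^ 2} ≤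
      ENNReal.ofReal (gaussianPDFReal 0 1 u / u) * dyadicTailSum R (a * K / 4) := by
  have hφ := gaussianPDFReal_nonneg 0 1 u
  rw [dyadicTailSum, ← ENNReal.tsum_mul_left]
  simp_rw [mul_left_comm (ENNReal.ofReal (gaussianPDFReal 0 1 u / u))]
  refine measure_exists_dyadic_le P
    (fun n k => {ω | X ω < u - a / u ∧
      K * (u * (u - X ω)) * (q ^ n) ^ 2 < (Z ((k + 1) / 2 ^ n) ω - Z (k / 2 ^ n) ω) ^ 2})
    _ fun n k hk => ?_
  obtain ⟨v, hv, hmap⟩ := hZ n k hk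
  have hRn : 1 ≤ R ^ n := one_le_pow₀ hR
  have hKR : 4 * 1 ≤ K * R ^ n := by gcongr
  have h := measure_lt_and_sq_gt_le hXm ((hZm _).sub (hZm _)) (hXZ n k hk) hX hmap hv
    (by positivity) hu ha (L := K * R ^ n / 2) (by linarith)
  refine (measure_mono ?_).trans (h.trans ?_)
  · rintro ω ⟨hω1, hω2⟩
    refine ⟨hω1, ?_⟩
    have e : 2 * ((w ^ n : NNReal) : ℝ) * (K * R ^ n / 2 * (u * (u - X ω))) =
        K * (u * (u - X ω)) * (q ^ n) ^ 2 := by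
      calc _ = K * (u * (u - X ω)) * ((w : ℝ) * R) ^ n := by push_cast; rw [mul_pow]; ring
        _ = _ := by rw [hwR]; ring
    exact e.trans_lt hω2
  · rw [← ENNReal.ofReal_mul (by positivity)]
    refine ENNReal.ofReal_le_ofReal ?_
    have hexp : a * K / 4 * R ^ n ≤ (K * R ^ n / 2 - 1) * a := by
      nlinarith [mul_le_mul_of_nonneg_left hKR ha.le]
    have hden : 1 ≤ K * R ^ n / 2 - 1 := by linarith
    calc _ ≤ 2 * gaussianPDFReal 0 1 u * Real.exp (-(a * K / 4 * R ^ n)) / (1 * u) := by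
          gcongr
      _ = _ := by ring

end Dyadic

/-- A crossing of `u` just before time one forces a large dyadic increment of the residual. -/
lemma exists_residual_increment_gt {Ω : Type*} {H : ℝ} {B : ℝ → Ω → ℝ} {ω : Ω}
    (hc : ContinuousOn (fun t => B t ω) (Icc 0 1))
    (hH : 1 / 2 < H) {K η : ℝ} (hK : 0 < K) (hη : η ≤ 1 / 2)
    (hKη : 50 * K * η ^ (H - 1 / 2) ≤ 1) {u t : ℝ} (hu : 0 < u) (hlt : B 1 ω < u)
    (ht : t ∈ Ioc (1 - η) 1) (hut : u < B t ω) :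
    ∃ n k : ℕ, k < 2 ^ n ∧ K * (u * (u - B 1 ω)) * (((1 / 2 : ℝ) ^ ((H + 1 / 2) / 2)) ^ n) ^ 2 <
      (fbmResidual H B ((k + 1) / 2 ^ n) ω - fbmResidual H B (k / 2 ^ n) ω) ^ 2 := by
  by_contra! hno
  have hH0 : 0 < H := by linarith
  have hy : 0 < u - B 1 ω := sub_pos.2 hlt
  have hA : 0 ≤ K * (u * (u - B 1 ω)) := by positivity
  have ht1 : t < 1 := by
    refine lt_of_le_of_ne ht.2 fun h => ?_
    rw [h] at hut; linarith
  have hδ : 0 < 1 - t := sub_pos.2 ht1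
  have ht0 : t ∈ Ico (0 : ℝ) 1 := ⟨by linarith [ht.1], ht1⟩
  have hcY : ContinuousOn (fun t => fbmResidual H B t ω) (Icc 0 1) :=
    hc.sub ((continuous_fbmCov_one hH0.le).continuousOn.mul continuousOn_const)
  have hY := abs_sub_one_le_of_dyadic hcY (Real.sqrt_nonneg (K * (u * (u - B 1 ω))))
    (γ := (H + 1 / 2) / 2) (by linarith) (fun n k hk => by
      have hq : (0 : ℝ) ≤ ((1 / 2 : ℝ) ^ ((H + 1 / 2) / 2)) ^ n := by positivity
      refine abs_le_of_sq_le_sq ?_ (by positivity)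
      rw [mul_pow, Real.sq_sqrt hA]
      exact hno n k hk) ht0
  have hY1 : fbmResidual H B 1 ω = 0 := by simp [fbmResidual, fbmCov_one_one hH0]
  simp only [hY1, sub_zero] at hY
  have hr1 := fbmCov_one_le hH.le (t := t) ⟨ht0.1, ht1.le⟩
  have hr2 := le_fbmCov_one hH.le (t := t) ⟨ht0.1, ht1.le⟩
  have hlow : u * (1 - t) / 2 + (u - B 1 ω) / 4 < fbmResidual H B t ω := by
    have h1 : u * (1 - t) / 2 ≤ u * (1 - fbmCov H t 1) := by nlinarith
    have h2 : (u - B 1 ω) / 4 ≤ fbmCov H t 1 * (u - B 1 ω) := by nlinarith [ht.1]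
    rw [fbmResidual]; linarith
  have hsq : (u * (1 - t) / 2 + (u - B 1 ω) / 4) ^ 2 <
      (5 * √(K * (u * (u - B 1 ω))) * (1 - t) ^ ((H + 1 / 2) / 2)) ^ 2 :=
    pow_lt_pow_left₀ (hlow.trans_le ((le_abs_self _).trans hY)) (by positivity) two_ne_zero
  have hpow : ((1 - t) ^ ((H + 1 / 2) / 2)) ^ 2 = (1 - t) * (1 - t) ^ (H - 1 / 2) := by
    rw [← Real.rpow_natCast, ← Real.rpow_mul hδ.le]
    conv_rhs => rw [← Real.rpow_one_add' hδ.le (by linarith)]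
    congr 1; push_cast; ring
  rw [mul_pow, mul_pow, Real.sq_sqrt hA, hpow] at hsq
  have hηδ : (1 - t) ^ (H - 1 / 2) ≤ η ^ (H - 1 / 2) :=
    Real.rpow_le_rpow hδ.le (by linarith [ht.1]) (by linarith)
  have hKδ : 50 * K * (1 - t) ^ (H - 1 / 2) ≤ 1 :=
    (mul_le_mul_of_nonneg_left hηδ (by positivity)).trans hKη
  have hprod : 0 < u * (u - B 1 ω) * (1 - t) := by positivity
  nlinarith [mul_le_mul_of_nonneg_left hKδ hprod.le,
    sq_nonneg (u * (1 - t) / 2 - (u - B 1 ω) / 4)]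

/-- Parameters of the dyadic chaining for Hurst exponent `H`. -/
lemma half_rpow_mul_two_rpow (H : ℝ) :
    (1 / 2 : ℝ) ^ (2 * H) * 2 ^ (H - 1 / 2) = ((1 / 2 : ℝ) ^ ((H + 1 / 2) / 2)) ^ 2 := by
  rw [← Real.rpow_natCast, ← Real.rpow_mul (by norm_num), one_div,
    Real.inv_rpow zero_le_two, Real.inv_rpow zero_le_two, ← Real.rpow_neg zero_le_two,
    ← Real.rpow_neg zero_le_two, ← Real.rpow_add zero_lt_two]
  congr 1; push_cast; ring

lemma abs_dyadic_step_rpow (H : ℝ) (n k : ℕ) :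
    |((k : ℝ) + 1) / 2 ^ n - k / 2 ^ n| ^ (2 * H) = ((1 / 2 : ℝ) ^ (2 * H)) ^ n := by
  have : ((k : ℝ) + 1) / 2 ^ n - k / 2 ^ n = (1 / 2) ^ n := by rw [div_pow]; ring
  rw [this, abs_of_nonneg (by positivity), ← Real.rpow_natCast, ← Real.rpow_mul (by norm_num),
    mul_comm, Real.rpow_mul (by norm_num), Real.rpow_natCast]

section Sup

variable {Ω : Type*} [MeasurableSpace Ω] {P : Measure Ω} {H : ℝ} {B : ℝ → Ω → ℝ}

/-- The probability of crossing `u` before time `1 - η` decays faster than `exp (-u ^ 2 / 2)`. -/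
lemma measure_exists_early_crossing_le (hB : IsCenteredGaussianCov P B (fbmCov H))
    (hH : 1 / 2 < H) {η : ℝ} (hη0 : 0 < η) (hη1 : η < 1) :
    ∃ C c : ℝ, 0 ≤ C ∧ 1 / 2 < c ∧ ∀ u, 1 ≤ u →
      P {ω | ContinuousOn (fun t => B t ω) (Icc 0 1) ∧ ∃ t ∈ Icc 0 (1 - η), u < B t ω} ≤
        ENNReal.ofReal (C * Real.exp (-(c * u ^ 2))) := by
  have hH0 : 0 < H := by linarith
  set q : ℝ := (1 / 2 : ℝ) ^ ((H + 1 / 2) / 2) with hq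
  set R : ℝ := 2 ^ (H - 1 / 2) with hR
  set w : NNReal := ⟨(1 / 2 : ℝ) ^ (2 * H), by positivity⟩ with hw
  have hR1 : 1 < R := Real.one_lt_rpow one_lt_two (by linarith)
  have hq0 : 0 < q := by positivity
  have hq1 : q ≤ 3 / 4 := by
    calc q ≤ (1 / 2 : ℝ) ^ (1 / 2 : ℝ) :=
          Real.rpow_le_rpow_of_exponent_ge (by norm_num) (by norm_num) (by linarith)
      _ ≤ 3 / 4 := by
          rw [← Real.sqrt_eq_rpow, Real.sqrt_le_left (by norm_num)]; norm_num
  obtain ⟨C, hC, hCb⟩ := dyadicTailSum_le hR1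
  obtain ⟨p, hp⟩ := exists_pow_lt_of_lt_one (show 0 < η / 24 by positivity)
    (show q < 1 by linarith)
  set c : ℝ := (1 - η / 4) ^ 2 / (2 * (1 - η)) with hc
  have hη' : 0 < 1 - η := by linarith
  have hc2 : 1 / 2 < c := by
    rw [hc, lt_div_iff₀ (by positivity)]; nlinarith
  refine ⟨2 ^ p * 2 + C, min c 1, by positivity, lt_min hc2 (by norm_num), fun u hu => ?_⟩
  have hu0 : 0 < u := by linarith
  set E₁ : Set Ω := ⋃ k ∈ (Finset.range (2 ^ p)).filter (fun k : ℕ => (k : ℝ) / 2 ^ p ≤ 1 - η),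
    {ω | 2 * (1 - η) * (c * u ^ 2) < B (k / 2 ^ p) ω ^ 2} with hE₁
  set E₂ : Set Ω := {ω | ∃ n k : ℕ, k < 2 ^ n ∧
    2 * u * q ^ n < |B ((k + 1) / 2 ^ n) ω - B (k / 2 ^ n) ω|} with hE₂
  have hP₁ : P E₁ ≤ ENNReal.ofReal (2 ^ p * (2 * Real.exp (-(c * u ^ 2)))) := by
    have hterm : ∀ k ∈ (Finset.range (2 ^ p)).filter (fun k : ℕ => (k : ℝ) / 2 ^ p ≤ 1 - η),
        P {ω | 2 * (1 - η) * (c * u ^ 2) < B (k / 2 ^ p) ω ^ 2} ≤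
          ENNReal.ofReal (2 * Real.exp (-(c * u ^ 2))) := by
      intro k hk
      have hk1 := (Finset.mem_filter.1 hk).2
      have hk0 : (0 : ℝ) ≤ k / 2 ^ p := by positivity
      obtain ⟨v, hv, hm⟩ := map_fbm hB hH0 hk0
      have hv' : (v : ℝ) ≤ 1 - η := by
        rw [hv]
        calc ((k : ℝ) / 2 ^ p) ^ (2 * H) ≤ ((k : ℝ) / 2 ^ p) ^ (1 : ℝ) :=
              Real.rpow_le_rpow_of_exponent_ge' hk0 (by linarith) zero_le_one (by linarith)
          _ ≤ _ := by rw [Real.rpow_one]; exact hk1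
      have hvw : v ≤ ⟨1 - η, hη'.le⟩ := hv'
      have h := gaussianReal_sq_gt_le hvw (z := c * u ^ 2) (by positivity) hη'
      rw [← hm, Measure.map_apply (hB.1 _) (measurableSet_lt (by fun_prop) (by fun_prop))] at h
      exact h
    refine (measure_biUnion_finset_le _ _).trans ((Finset.sum_le_sum hterm).trans ?_)
    rw [Finset.sum_const, nsmul_eq_mul, ENNReal.ofReal_mul (p := 2 ^ p) (by positivity)]
    refine mul_le_mul' ?_ le_rfl
    rw [ENNReal.ofReal_pow zero_le_two]
    have : ((Finset.range (2 ^ p)).filter (fun k : ℕ => (k : ℝ) / 2 ^ p ≤ 1 - η)).card ≤ 2 ^ p :=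
      (Finset.card_filter_le _ _).trans (by simp)
    simpa using (by exact_mod_cast this :
      (((Finset.range (2 ^ p)).filter (fun k : ℕ => (k : ℝ) / 2 ^ p ≤ 1 - η)).card : ENNReal)
        ≤ 2 ^ p)
  have hP₂ : P E₂ ≤ ENNReal.ofReal (C * Real.exp (-u ^ 2)) := by
    refine (measure_exists_dyadic_increment_gt_le hB.1 (w := w)
      (show (0 : ℝ) < (1 / 2 : ℝ) ^ (2 * H) by positivity) (R := R) (by linarith) hq0.le
      (half_rpow_mul_two_rpow H) (fun n k _ => ?_) (by positivity)).trans ?_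
    · obtain ⟨v, hv, hm⟩ := map_fbm_sub hB hH0 (s := (k + 1) / 2 ^ n) (t := k / 2 ^ n)
        (by positivity) (by positivity)
      refine ⟨v, ?_, hm⟩
      rw [← NNReal.coe_le_coe, hv, abs_dyadic_step_rpow]
      rfl
    · refine (hCb _ (by nlinarith)).trans (ENNReal.ofReal_le_ofReal ?_)
      gcongr
      nlinarith
  have hsub : {ω | ContinuousOn (fun t => B t ω) (Icc 0 1) ∧ ∃ t ∈ Icc 0 (1 - η), u < B t ω} ⊆
      E₁ ∪ E₂ := by
    rintro ω ⟨hcont, t, ht, hut⟩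
    by_cases h2 : ω ∈ E₂
    · exact Or.inr h2
    left
    have hinc : ∀ n k : ℕ, k < 2 ^ n →
        |B ((k + 1) / 2 ^ n) ω - B (k / 2 ^ n) ω| ≤ 2 * u * q ^ n := by
      intro n k hk
      by_contra! hcon
      exact h2 ⟨n, k, hk, hcon⟩
    have ht1 : t < 1 := by linarith [ht.2]
    have happ := abs_sub_dyadic_floor_le hcont (by positivity) hq0.le hq1 hinc ⟨ht.1, ht1⟩ p
    have hfl := Nat.floor_le (mul_nonneg ht.1 (by positivity : (0 : ℝ) ≤ 2 ^ p))
    rw [hE₁, mem_iUnion₂]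
    refine ⟨⌊t * 2 ^ p⌋₊, Finset.mem_filter.2 ⟨Finset.mem_range.2 ?_, ?_⟩, ?_⟩
    · rw [Nat.floor_lt (by positivity [ht.1])]
      push_cast
      nlinarith [show (0 : ℝ) < 2 ^ p by positivity]
    · rw [div_le_iff₀ (by positivity)]
      exact hfl.trans (by gcongr; exact ht.2)
    · have h3 : u * (1 - η / 4) < B (⌊t * 2 ^ p⌋₊ / 2 ^ p) ω := by
        have h5 := (abs_le.1 happ).2
        have h6 : 3 * (2 * u) * q ^ p ≤ u * (η / 4) := by nlinarith
        linarith
      have h4 : 2 * (1 - η) * (c * u ^ 2) = (u * (1 - η / 4)) ^ 2 := by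
        rw [hc]; field_simp
      simp only [mem_ofPred_eq]
      rw [h4]
      exact pow_lt_pow_left₀ h3 (mul_nonneg hu0.le (by linarith)) two_ne_zero
  refine (measure_mono hsub).trans ((measure_union_le _ _).trans ((add_le_add hP₁ hP₂).trans ?_))
  rw [← ENNReal.ofReal_add (by positivity) (by positivity)]
  refine ENNReal.ofReal_le_ofReal ?_
  have e1 : Real.exp (-(c * u ^ 2)) ≤ Real.exp (-(min c 1 * u ^ 2)) := by
    gcongr; exact min_le_left _ _
  have e2 : Real.exp (-u ^ 2) ≤ Real.exp (-(min c 1 * u ^ 2)) := by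
    apply Real.exp_le_exp.2
    nlinarith [min_le_right c 1, sq_nonneg u]
  rw [add_mul, mul_assoc]
  gcongr

/-- The probability of a crossing of `u` in `(1 - η, 1]` while `B 1 < u - a / u`. -/
lemma measure_late_crossing_le [IsProbabilityMeasure P]
    (hB : IsCenteredGaussianCov P B (fbmCov H)) (hH : 1 / 2 < H) {K η : ℝ} (hK : 4 ≤ K)
    (hη : η ≤ 1 / 2) (hKη : 50 * K * η ^ (H - 1 / 2) ≤ 1) {u a : ℝ} (hu : 0 < u) (ha : 0 < a) :
    P {ω | ContinuousOn (fun t => B t ω) (Icc 0 1) ∧ B 1 ω < u - a / u ∧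
        ∃ t ∈ Ioc (1 - η) 1, u < B t ω} ≤
      ENNReal.ofReal (gaussianPDFReal 0 1 u / u) *
        dyadicTailSum (2 ^ (H - 1 / 2)) (a * K / 4) := by
  have hH0 : 0 < H := by linarith
  set w : NNReal := ⟨(1 / 2 : ℝ) ^ (2 * H), by positivity⟩ with hw
  refine (measure_mono ?_).trans (measure_lt_and_exists_dyadic_increment_gt_le (hB.1 1)
    (measurable_fbmResidual hB) (map_fbm_one hB hH0) (w := w)
    (show (0 : ℝ) < (1 / 2 : ℝ) ^ (2 * H) by positivity)
    (Real.one_le_rpow one_le_two (by linarith)) (half_rpow_mul_two_rpow H)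
    (fun n k _ => ?_) (fun n k _ => ?_) hu ha hK)
  · rintro ω ⟨hc, hlt, t, ht, hut⟩
    have hlt' : B 1 ω < u := hlt.trans (sub_lt_self _ (by positivity))
    obtain ⟨n, k, hk, h⟩ := exists_residual_increment_gt hc hH (by linarith) hη hKη hu hlt' ht hut
    exact ⟨n, k, hk, hlt, h⟩
  · obtain ⟨v, hv, hm⟩ := map_fbmResidual_sub hB hH0 (s := (k + 1) / 2 ^ n) (t := k / 2 ^ n)
      (by positivity) (by positivity)
    refine ⟨v, ?_, hm⟩
    rw [abs_dyadic_step_rpow] at hv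
    exact_mod_cast hv
  · exact indepFun_fbm_one_residual_sub hB hH0 (by positivity) (by positivity)

end Sup

section Main

variable {Ω : Type*} [MeasurableSpace Ω] {P : Measure Ω} [IsProbabilityMeasure P] {H : ℝ}
  {B : ℝ → Ω → ℝ}

/-- A non-asymptotic upper bound for the tail of the supremum, relative to the Mills ratio. -/
lemma measure_lt_sSup_fbm_le (hB : IsFBM P H B) (hH : H ∈ Ioc (1 / 2 : ℝ) 1) {ε : ℝ}
    (hε : 0 < ε) :
    ∃ a C c : ℝ, 0 < a ∧ Real.exp a ≤ 1 + ε ∧ 1 / 2 < c ∧ 0 ≤ C ∧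
      ∀ u, 1 ≤ u → 0 < u - a / u →
      P.real {ω | u < sSup ((fun t => B t ω) '' Icc 0 1)} ≤
        gaussianPDFReal 0 1 (u - a / u) / (u - a / u) + gaussianPDFReal 0 1 u / u * ε +
          C * Real.exp (-(c * u ^ 2)) := by
  have hH1 : 1 / 2 < H := hH.1
  have hH0 : 0 < H := by linarith
  set ρ := H - 1 / 2 with hρ
  have hρ0 : 0 < ρ := by linarith
  obtain ⟨a, ha, hae⟩ : ∃ a : ℝ, 0 < a ∧ Real.exp a ≤ 1 + ε :=
    ⟨Real.log (1 + ε), Real.log_pos (by linarith), (Real.exp_log (by linarith)).le⟩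
  obtain ⟨C₀, -, hCb⟩ := dyadicTailSum_le
    (Real.one_lt_rpow one_lt_two hρ0 : (1 : ℝ) < 2 ^ ρ)
  have hlim : Tendsto (fun K : ℝ => C₀ * Real.exp (-(a * K / 4 / 2))) atTop (nhds 0) := by
    rw [← mul_zero C₀]
    refine (Real.tendsto_exp_neg_atTop_nhds_zero.comp ?_).const_mul C₀
    have : (fun K : ℝ => a * K / 4 / 2) = fun K => K * (a / 8) := by ext K; ring
    rw [this]
    exact tendsto_id.atTop_mul_const (by positivity)
  obtain ⟨K, hKε, hK4, hKa⟩ := ((hlim.eventually_lt_const hε).and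
    ((eventually_ge_atTop 4).and (eventually_ge_atTop (4 / a)))).exists
  have haK : 1 ≤ a * K / 4 := by
    rw [div_le_iff₀ ha] at hKa; linarith
  set b : ℝ := 1 / (50 * K) with hb
  have hb0 : 0 < b := by positivity
  have hb1 : b ≤ 1 / 2 := by
    rw [hb]; exact one_div_le_one_div_of_le two_pos (by linarith)
  set η : ℝ := b ^ (1 / ρ) with hη
  have hη0 : 0 < η := by positivity
  have hη1 : η ≤ 1 / 2 := by
    refine le_trans ?_ hb1
    conv_rhs => rw [← Real.rpow_one b]
    refine Real.rpow_le_rpow_of_exponent_ge hb0 (by linarith) ?_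
    rw [le_div_iff₀ hρ0]; linarith [hH.2]
  have hKη : 50 * K * η ^ ρ ≤ 1 := by
    rw [hη, ← Real.rpow_mul hb0.le, one_div_mul_cancel hρ0.ne', Real.rpow_one, hb]
    exact (mul_one_div_cancel (by positivity)).le
  obtain ⟨C, c, hC, hc, hearly⟩ :=
    measure_exists_early_crossing_le hB.1 hH1 hη0 (by linarith)
  refine ⟨a, C, c, ha, hae, hc, hC, fun u hu hu' => ?_⟩
  have hu0 : 0 < u := by linarith
  have h1 : P {ω | u - a / u ≤ B 1 ω} ≤
      ENNReal.ofReal (gaussianPDFReal 0 1 (u - a / u) / (u - a / u)) := by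
    have h := gaussianReal_Ici_le hu'
    rwa [← map_fbm_one hB.1 hH0, Measure.map_apply (hB.1.1 1) measurableSet_Ici] at h
  have h2 := (measure_late_crossing_le hB.1 hH1 hK4 hη1 hKη hu0 ha).trans
    (mul_le_mul_right ((hCb _ haK).trans (ENNReal.ofReal_le_ofReal hKε.le)) _)
  have h3 := hearly u hu
  have hφ : 0 ≤ gaussianPDFReal 0 1 u / u := div_nonneg (gaussianPDFReal_nonneg _ _ _) hu0.le
  have hφ' : 0 ≤ gaussianPDFReal 0 1 (u - a / u) / (u - a / u) :=
    div_nonneg (gaussianPDFReal_nonneg _ _ _) hu'.le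
  have hsub : ({ω | u < sSup ((fun t => B t ω) '' Icc 0 1)} : Set Ω) ≤ᵐ[P]
      ({ω | u - a / u ≤ B 1 ω} ∪
        {ω | ContinuousOn (fun t => B t ω) (Icc 0 1) ∧ B 1 ω < u - a / u ∧
          ∃ t ∈ Ioc (1 - η) 1, u < B t ω} ∪
        {ω | ContinuousOn (fun t => B t ω) (Icc 0 1) ∧ ∃ t ∈ Icc 0 (1 - η), u < B t ω} :
          Set Ω) := by
    filter_upwards [hB.2.1] with ω hω hsup
    have hcont := hω.mono (Icc_subset_Ici_self : Icc (0 : ℝ) 1 ⊆ Ici 0)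
    obtain ⟨_, ⟨t, ht, rfl⟩, hut⟩ :=
      exists_lt_of_lt_csSup ((nonempty_Icc.2 zero_le_one).image _) hsup
    by_cases h : u - a / u ≤ B 1 ω
    · exact Or.inl (Or.inl h)
    rcases le_or_gt t (1 - η) with htη | htη
    · exact Or.inr ⟨hcont, t, ⟨ht.1, htη⟩, hut⟩
    · exact Or.inl (Or.inr ⟨hcont, not_le.1 h, t, ⟨htη, ht.2⟩, hut⟩)
  refine ENNReal.toReal_le_of_le_ofReal (by positivity) ?_
  rw [ENNReal.ofReal_add (by positivity) (by positivity), ENNReal.ofReal_add hφ' (by positivity),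
    ENNReal.ofReal_mul hφ]
  exact (measure_mono_ae hsub).trans ((measure_union_le _ _).trans
    (add_le_add ((measure_union_le _ _).trans (add_le_add h1 h2)) h3))

lemma le_measure_lt_sSup_fbm (hB : IsFBM P H B) (hH : 0 < H) (u : ℝ) :
    gaussianPDFReal 0 1 u * (u / (1 + u ^ 2)) ≤
      P.real {ω | u < sSup ((fun t => B t ω) '' Icc 0 1)} := by
  refine (le_gaussianReal_Ioi u).trans ?_
  rw [← map_fbm_one hB.1 hH, map_measureReal_apply (hB.1.1 1) measurableSet_Ioi]
  refine ENNReal.toReal_mono (measure_ne_top _ _) (measure_mono_ae ?_)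
  filter_upwards [hB.2.1] with ω hω hlt
  have hcont := hω.mono (Icc_subset_Ici_self : Icc (0 : ℝ) 1 ⊆ Ici 0)
  exact lt_of_lt_of_le hlt (le_csSup (isCompact_Icc.image_of_continuousOn hcont).bddAbove
    (mem_image_of_mem (fun t => B t ω) (right_mem_Icc.2 zero_le_one)))

end Main

/-- Shifting the level by `a / u` multiplies the Mills ratio by asymptotically `exp a`. -/
lemma mills_shift_le {u a : ℝ} (hu : 0 < u) (hu' : 0 < u - a / u) :
    gaussianPDFReal 0 1 (u - a / u) / (u - a / u) ≤
      gaussianPDFReal 0 1 u / u * (Real.exp a / (1 - a / u ^ 2)) := by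
  have h := gaussianPDFReal_le_mul_exp u (u - a / u)
  have e : u * (u - (u - a / u)) = a := by field_simp; ring
  rw [e] at h
  have e2 : gaussianPDFReal 0 1 u / u * (Real.exp a / (1 - a / u ^ 2)) =
      gaussianPDFReal 0 1 u * Real.exp a / (u - a / u) := by
    rw [div_mul_div_comm]; congr 1; field_simp
  rw [e2]
  gcongr

lemma tendsto_exp_div_gaussianPDFReal {c : ℝ} (hc : 1 / 2 < c) :
    Tendsto (fun u : ℝ => Real.exp (-(c * u ^ 2)) / (gaussianPDFReal 0 1 u / u))
      atTop (nhds 0) := by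
  have h := tendsto_rpow_mul_exp_neg_mul_atTop_nhds_zero 1 (c - 1 / 2) (by linarith)
  refine squeeze_zero' (g := fun u : ℝ =>
      √(2 * Real.pi) * (u ^ (1 : ℝ) * Real.exp (-(c - 1 / 2) * u))) ?_ ?_ ?_
  · filter_upwards [eventually_gt_atTop 0] with u hu
    exact div_nonneg (Real.exp_pos _).le (div_nonneg (gaussianPDFReal_nonneg _ _ _) hu.le)
  · filter_upwards [eventually_ge_atTop 1] with u hu
    have hπ : 0 < √(2 * Real.pi) := by positivity
    have e : Real.exp (-(c * u ^ 2)) / (gaussianPDFReal 0 1 u / u) =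
        √(2 * Real.pi) * (u * Real.exp (-(c - 1 / 2) * u ^ 2)) := by
      rw [gaussianPDFReal_zero_one]
      have : Real.exp (-(c * u ^ 2)) =
          Real.exp (-(c - 1 / 2) * u ^ 2) * Real.exp (-u ^ 2 / 2) := by
        rw [← Real.exp_add]; congr 1; ring
      rw [this]
      field_simp
    rw [e, Real.rpow_one]
    have : Real.exp (-(c - 1 / 2) * u ^ 2) ≤ Real.exp (-(c - 1 / 2) * u) :=
      Real.exp_le_exp.2 (by
        nlinarith [mul_le_mul_of_nonneg_left hu
          (mul_nonneg (sub_pos.2 hc).le (by linarith : 0 ≤ u))])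
    gcongr
  · simpa using h.const_mul √(2 * Real.pi)

/-- Lemma 4.2 (iii): for fBm with Hurst parameter `H ∈ (1/2, 1]`,
`ℙ(sup_{[0,1]} B_H > u) = (1/√(2π)) u^{-1} exp(-u²/2) (1+o(1))` as `u → ∞`. -/
theorem sup_fbm_unit_interval_high_hurst {Ω : Type*} [MeasurableSpace Ω]
    (P : Measure Ω) [IsProbabilityMeasure P]
    (H : ℝ) (hH : H ∈ Set.Ioc (1 / 2 : ℝ) 1)
    (B : ℝ → Ω → ℝ) (hB : IsFBM P H B) :
    MemW P (fun ω => sSup ((fun t => B t ω) '' Set.Icc (0 : ℝ) 1))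
      2 (1 / 2) (-1) (1 / Real.sqrt (2 * Real.pi)) := by
  have hden : ∀ u : ℝ, 0 < u → 1 / Real.sqrt (2 * Real.pi) * u ^ (-1 : ℝ) *
      Real.exp (-(1 / 2) * u ^ (2 : ℝ)) = gaussianPDFReal 0 1 u / u := fun u hu => by
    rw [gaussianPDFReal_zero_one, Real.rpow_neg_one, Real.rpow_two]
    have : -(1 / 2) * u ^ 2 = -u ^ 2 / 2 := by ring
    rw [this]; field_simp
  have hφ : ∀ u : ℝ, 0 < u → 0 < gaussianPDFReal 0 1 u / u := fun u hu =>
    div_pos (gaussianPDFReal_pos _ _ _ one_ne_zero) hu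
  rw [MemW]
  refine Tendsto.congr' (f₁ := fun u : ℝ => P.real {ω | u < sSup ((fun t => B t ω) '' Icc 0 1)} /
    (gaussianPDFReal 0 1 u / u)) ?_ ?_
  · filter_upwards [eventually_gt_atTop 0] with u hu
    rw [hden u hu]; rfl
  have hsq : Tendsto (fun u : ℝ => u ^ 2) atTop atTop := tendsto_pow_atTop two_ne_zero
  have hinv : ∀ a : ℝ, Tendsto (fun u : ℝ => a / u ^ 2) atTop (nhds 0) := fun a =>
    hsq.const_div_atTop a
  refine tendsto_order.2 ⟨fun l hl => ?_, fun r hr => ?_⟩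
  · have hlow : Tendsto (fun u : ℝ => 1 / (1 + 1 / u ^ 2)) atTop (nhds 1) := by
      have h := (tendsto_const_nhds (x := (1 : ℝ))).div ((hinv 1).const_add 1) (by norm_num)
      simpa [Pi.div_def] using h
    filter_upwards [hlow.eventually_const_lt hl, eventually_gt_atTop 0] with u hlu hu
    refine hlu.trans_le ?_
    rw [le_div_iff₀ (hφ u hu)]
    refine le_trans (le_of_eq ?_) (le_measure_lt_sSup_fbm hB (by linarith [hH.1]) u)
    field_simp
    ring
  · obtain ⟨ε, hε, hεr⟩ : ∃ ε > 0, 1 + 2 * ε < r := ⟨(r - 1) / 4, by linarith, by linarith⟩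
    obtain ⟨a, C, c, ha, hae, hc, hC, hup⟩ := measure_lt_sSup_fbm_le hB hH hε
    have hlim : Tendsto (fun u : ℝ => Real.exp a / (1 - a / u ^ 2) + ε +
        C * (Real.exp (-(c * u ^ 2)) / (gaussianPDFReal 0 1 u / u)))
        atTop (nhds (Real.exp a + ε)) := by
      have h1 := (tendsto_const_nhds (x := Real.exp a)).div ((hinv a).const_sub 1) (by norm_num)
      simpa using (h1.add_const ε).add ((tendsto_exp_div_gaussianPDFReal hc).const_mul C)
    have hpos : ∀ᶠ u : ℝ in atTop, a / u ^ 2 < 1 := (hinv a).eventually_lt_const one_pos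
    filter_upwards [hlim.eventually_lt_const (show Real.exp a + ε < r by linarith), hpos,
      eventually_ge_atTop 1] with u hlu hau hu
    have hu0 : 0 < u := by linarith
    have hu' : 0 < u - a / u := by
      have e : u - a / u = u * (1 - a / u ^ 2) := by field_simp
      rw [e]; exact mul_pos hu0 (sub_pos.2 hau)
    refine lt_of_le_of_lt ?_ hlu
    rw [div_le_iff₀ (hφ u hu0)]
    refine (hup u hu hu').trans ?_
    rw [add_mul, add_mul, mul_assoc C, div_mul_cancel₀ _ (hφ u hu0).ne']
    have := mills_shift_le hu0 hu'
    linarith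
end
end

section
/- Let {X(t) : t ≥ 0} be a centered Gaussian process with stationary increments, a.s. continuous sample paths, X(0) = 0 a.s., and variance function σ²_X satisfying A1–A3 with index α_∞ ∈ (1,2), and let α > 0. Set τ₁ = 2/(α_∞ + 2α), τ₂ = 4/(2α_∞ + α), and δ = δ(u, t) = (σ³_X(t)/σ̇_X(t)) · 2 u^{−2} log² u, where σ̇_X denotes the derivative of σ_X. Then for all sufficiently large u, uniformly for all t ∈ [u^{τ₁}, u^{τ₂}], ℙ( sup_{s ∈ [0, t−δ]} X(s) > u ) ≤ Ψ( u/σ_X(t) ) · exp( −log²(u)/2 ), where Ψ(v) = ℙ(N > v) is the tail of the standard normal distribution. -/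
open MeasureTheory ProbabilityTheory Filter Set

noncomputable section

/-- Tail of the standard normal distribution: `Ψ(v) = ℙ(N > v)`. -/
def stdNormalTail (v : ℝ) : ℝ := ((gaussianReal 0 1) (Set.Ioi v)).toReal

/-- `δ(u,t) = (σ_X³(t)/σ̇_X(t)) · 2 u⁻² log² u`, where `σ_X = √σ²_X` and
`σ̇_X = d/(2σ_X)` with `d` the derivative of `σ²_X`. -/
def deltaFn (σ2 d : ℝ → ℝ) (u t : ℝ) : ℝ :=
  Real.sqrt (σ2 t) ^ (3 : ℕ) / (d t / (2 * Real.sqrt (σ2 t))) *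
    (2 * u⁻¹ ^ (2 : ℕ) * Real.log u ^ (2 : ℕ))

section Chaining

/-- If a function is at most `a` on a coarse grid and its increments along the successive dyadic
refinements are at most `b i`, then it is controlled on all refinements. -/
lemma dyadic_grid_le {f : ℝ → ℝ} {T a : ℝ} {N : ℕ} (hN : 0 < N) {b : ℕ → ℝ}
    (hb : ∀ i, 0 ≤ b i)
    (h0 : ∀ j : ℕ, j ≤ N → f (T * j / N) ≤ a)
    (hinc : ∀ i j : ℕ, j < N * 2 ^ (i + 1) →
      f (T * (j + 1) / (N * 2 ^ (i + 1))) - f (T * j / (N * 2 ^ (i + 1))) ≤ b i) (m : ℕ) :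
    ∀ j : ℕ, j ≤ N * 2 ^ m → f (T * j / (N * 2 ^ m)) ≤ a + ∑ i ∈ Finset.range m, b i := by
  have hN' : (0 : ℝ) < N := by exact_mod_cast hN
  induction m with
  | zero => intro j hj; simpa using h0 j (by simpa using hj)
  | succ m ih =>
    intro j hj
    rw [Finset.sum_range_succ]
    have key : ∀ k : ℕ, T * ((2 * k : ℕ) : ℝ) / (N * 2 ^ (m + 1)) = T * k / (N * 2 ^ m) := by
      intro k
      push_cast
      rw [pow_succ]
      field_simp
    have hp : N * 2 ^ (m + 1) = 2 * (N * 2 ^ m) := by ring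
    rcases Nat.even_or_odd' j with ⟨k, rfl | rfl⟩
    · rw [key]
      have := ih k (by omega)
      linarith [hb m]
    · have h1 := ih k (by omega)
      have h2 := hinc m (2 * k) (by omega)
      rw [key] at h2
      push_cast at h2 ⊢
      linarith

/-- A function continuous on `[0, T]` and bounded by `c` on all dyadic refinements of a grid is
bounded by `c`. -/
lemma le_of_dyadic_grid_le {f : ℝ → ℝ} {T c : ℝ} (hT : 0 ≤ T) {N : ℕ} (hN : 0 < N)
    (hf : ContinuousOn f (Ici 0))
    (h : ∀ m j : ℕ, j ≤ N * 2 ^ m → f (T * j / (N * 2 ^ m)) ≤ c) {s : ℝ} (hs : s ∈ Icc 0 T) :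
    f s ≤ c := by
  have hN' : (0 : ℝ) < N := by exact_mod_cast hN
  rcases hT.eq_or_lt with rfl | hT
  · have : s = 0 := le_antisymm hs.2 hs.1
    simpa [this] using h 0 0 (Nat.zero_le _)
  set M : ℕ → ℝ := fun m => N * 2 ^ m with hM
  have hMpos : ∀ m, 0 < M m := fun m => by positivity
  set j : ℕ → ℕ := fun m => ⌊s * M m / T⌋₊ with hj
  have hle : ∀ m, T * j m / M m ≤ s := by
    intro m
    have := Nat.floor_le (a := s * M m / T) (div_nonneg (mul_nonneg hs.1 (hMpos m).le) hT.le)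
    rw [le_div_iff₀ hT] at this
    rw [div_le_iff₀ (hMpos m)]
    simpa [hj, mul_comm] using this
  have hge : ∀ m, s - T / M m ≤ T * j m / M m := by
    intro m
    have := (Nat.lt_floor_add_one (s * M m / T)).le
    rw [div_le_iff₀ hT] at this
    rw [sub_le_iff_le_add, ← add_div, le_div_iff₀ (hMpos m)]
    linarith
  have hMtop : Tendsto M atTop atTop :=
    (tendsto_pow_atTop_atTop_of_one_lt (by norm_num : (1 : ℝ) < 2)).const_mul_atTop hN'
  have hlim : Tendsto (fun m => T * j m / M m) atTop (nhds s) := by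
    refine tendsto_of_tendsto_of_tendsto_of_le_of_le ?_ tendsto_const_nhds hge hle
    simpa using (tendsto_const_nhds (x := s)).sub (hMtop.const_div_atTop T)
  have hlim' : Tendsto (fun m => T * j m / M m) atTop (nhdsWithin s (Ici 0)) :=
    tendsto_nhdsWithin_iff.2 ⟨hlim, Eventually.of_forall fun m =>
      div_nonneg (mul_nonneg hT.le (Nat.cast_nonneg _)) (hMpos m).le⟩
  refine le_of_tendsto ((hf s hs.1).tendsto.comp hlim') (Eventually.of_forall fun m => ?_)
  refine h m (j m) ?_
  have : (j m : ℝ) ≤ M m := by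
    have h1 := hle m
    rw [div_le_iff₀ (hMpos m)] at h1
    have : T * j m ≤ T * M m := h1.trans (by gcongr; exact hs.2)
    exact le_of_mul_le_mul_left this hT
  have h2 : ((j m : ℕ) : ℝ) ≤ ((N * 2 ^ m : ℕ) : ℝ) := by push_cast; exact this
  exact_mod_cast h2

/-- Chaining bound for the supremum of a process with sub-Gaussian one-dimensional marginals
and increments. -/
lemma measureReal_lt_sSup_le {Ω : Type*} [MeasurableSpace Ω] (P : Measure Ω)
    [IsProbabilityMeasure P] {X : ℝ → Ω → ℝ}
    (hpath : ∀ᵐ ω ∂P, ContinuousOn (fun t => X t ω) (Ici 0))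
    {T u η S D r : ℝ} (hu : 0 < u) (hη : 0 < η) (hηu : η ≤ u) (hD : 0 < D) (hr : 0 < r)
    (hr1 : r ≤ 1)
    {N : ℕ} (hN : 0 < N) (hTN : T ≤ N * r)
    (hpt : ∀ s ∈ Icc 0 T, ∀ x, 0 ≤ x → P.real {ω | x ≤ X s ω} ≤ Real.exp (-x ^ 2 / (2 * S)))
    (hinc : ∀ s t q, 0 ≤ s → s ≤ t → t - s ≤ q → 0 < q → q ≤ 1 → ∀ x, 0 ≤ x →
      P.real {ω | x ≤ X t ω - X s ω} ≤ Real.exp (-x ^ 2 / (2 * (D * q))))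
    (hE : 12 ≤ η ^ 2 / (16 * (D * r))) :
    P.real {ω | u < sSup ((fun s => X s ω) '' Icc 0 T)} ≤
      (N + 1) * Real.exp (-(u - η) ^ 2 / (2 * S)) +
        4 * N * Real.exp (-(η ^ 2 / (16 * (D * r)))) := by
  have hN' : (0 : ℝ) < N := by exact_mod_cast hN
  set E := η ^ 2 / (16 * (D * r)) with hEdef
  rcases lt_or_ge T 0 with hT | hT
  · have : {ω | u < sSup ((fun s => X s ω) '' Icc 0 T)} = ∅ := by
      ext ω; simp [Icc_eq_empty (not_le.2 hT), hu.le]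
    rw [this, measureReal_empty]; positivity
  set b : ℕ → ℝ := fun i => η / 4 * (3 / 4) ^ i with hbdef
  have hb : ∀ i, 0 ≤ b i := fun i => by positivity
  have hbsum : ∀ m, ∑ i ∈ Finset.range m, b i ≤ η := by
    intro m
    rw [← Finset.mul_sum, geom_sum_eq (by norm_num)]
    have h1 : 0 ≤ η * (3 / 4) ^ m := by positivity
    have h2 : η / 4 * (((3 / 4) ^ m - 1) / (3 / 4 - 1)) = η - η * (3 / 4) ^ m := by ring
    linarith
  set A0 : ℕ → Set Ω := fun j => {ω | u - η ≤ X (T * j / N) ω}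
  set A : ℕ → ℕ → Set Ω := fun i j =>
    {ω | b i ≤ X (T * (j + 1) / (N * 2 ^ (i + 1))) ω - X (T * j / (N * 2 ^ (i + 1))) ω}
  have hA0 : ∀ j ∈ Finset.range (N + 1),
      P (A0 j) ≤ ENNReal.ofReal (Real.exp (-(u - η) ^ 2 / (2 * S))) := by
    intro j hj
    rw [ENNReal.le_ofReal_iff_toReal_le (measure_ne_top _ _) (Real.exp_pos _).le]
    have hjN : (j : ℝ) ≤ N := by
      have := Finset.mem_range.1 hj
      exact_mod_cast Nat.lt_succ_iff.1 this
    refine hpt _ ⟨by positivity, ?_⟩ _ (by linarith)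
    rw [div_le_iff₀ hN']; gcongr
  have hA : ∀ i j, P (A i j) ≤ ENNReal.ofReal (Real.exp (-E) * (1 / 4) ^ i) := by
    intro i j
    have hd : (T * (j + 1) / (N * 2 ^ (i + 1)) : ℝ) - T * j / (N * 2 ^ (i + 1))
        = T / (N * 2 ^ (i + 1)) := by ring
    rw [ENNReal.le_ofReal_iff_toReal_le (measure_ne_top _ _) (by positivity)]
    refine (hinc _ _ (r / 2 ^ (i + 1)) (by positivity) ?_ ?_ (by positivity) ?_ (b i)
      (hb i)).trans ?_
    · gcongr; linarith
    · rw [hd, div_le_div_iff₀ (by positivity) (by positivity)]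
      nlinarith [pow_pos (two_pos : (0 : ℝ) < 2) (i + 1)]
    · exact (div_le_self hr.le (one_le_pow₀ (by norm_num))).trans hr1
    · have h1 : -(b i) ^ 2 / (2 * (D * (r / 2 ^ (i + 1)))) = -(E * (9 / 8) ^ i) := by
        have : ((9 : ℝ) / 8) ^ i = ((3 / 4) ^ i) ^ 2 * 2 ^ i := by
          rw [← pow_mul, mul_comm i 2, pow_mul, ← mul_pow]; norm_num
        rw [this, hEdef, hbdef, pow_succ]
        field_simp
        ring
      have h2 : 1 + (i : ℝ) * (1 / 8) ≤ (9 / 8) ^ i := by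
        have := one_add_mul_le_pow (a := (1 / 8 : ℝ)) (by norm_num) i
        norm_num at this ⊢
        exact this
      have h3 : Real.exp (-(3 / 2)) ≤ 1 / 4 := by
        rw [Real.exp_neg, inv_le_comm₀ (Real.exp_pos _) (by norm_num)]
        have h4 : Real.exp (3 / 2) ^ 2 = Real.exp 1 ^ 3 := by
          rw [← Real.exp_nat_mul, ← Real.exp_nat_mul]; norm_num
        have h5 := Real.exp_one_gt_d9
        have h6 : (16 : ℝ) ≤ Real.exp 1 ^ 3 := by
          calc (16 : ℝ) ≤ 2.7 ^ 3 := by norm_num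
            _ ≤ _ := by gcongr; linarith
        have h7 : (4 : ℝ) ^ 2 ≤ Real.exp (3 / 2) ^ 2 := by rw [h4]; linarith
        have := abs_le_of_sq_le_sq h7 (Real.exp_pos _).le
        rw [abs_of_pos (by norm_num)] at this
        rwa [one_div, inv_inv]
      calc Real.exp (-(b i) ^ 2 / (2 * (D * (r / 2 ^ (i + 1)))))
          ≤ Real.exp (-E + i * (-(3 / 2))) := by
            rw [h1]
            apply Real.exp_le_exp.2
            have hi : (0 : ℝ) ≤ i := Nat.cast_nonneg i
            nlinarith [mul_le_mul_of_nonneg_left h2 (by linarith : 0 ≤ E)]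
        _ = Real.exp (-E) * Real.exp (-(3 / 2)) ^ i := by rw [Real.exp_add, Real.exp_nat_mul]
        _ ≤ _ := by gcongr
  have hsub : ∀ᵐ ω ∂P, ω ∈ {ω | u < sSup ((fun s => X s ω) '' Icc 0 T)} →
      ω ∈ (⋃ j ∈ Finset.range (N + 1), A0 j) ∪
        ⋃ i, ⋃ j ∈ Finset.range (N * 2 ^ (i + 1)), A i j := by
    filter_upwards [hpath] with ω hω h
    by_contra hcon
    simp only [mem_union, mem_iUnion, not_or, not_exists] at hcon
    obtain ⟨hc0, hc⟩ := hcon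
    obtain ⟨_, ⟨s, hs, rfl⟩, hlt⟩ := exists_lt_of_lt_csSup
      ((nonempty_Icc.2 hT).image _) h
    refine absurd (le_of_dyadic_grid_le hT hN hω (c := u) (fun m j hj => ?_) hs) (not_le.2 hlt)
    have := dyadic_grid_le (f := fun t => X t ω) (T := T) (a := u - η) hN hb (fun j hj => ?_)
      (fun i j hj => ?_) m j hj
    · linarith [hbsum m]
    · exact (not_le.1 (hc0 j (Finset.mem_range.2 (Nat.lt_succ_of_le hj)))).le
    · exact (not_le.1 (hc i j (Finset.mem_range.2 hj))).le
  have hmeas : P {ω | u < sSup ((fun s => X s ω) '' Icc 0 T)} ≤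
      ENNReal.ofReal ((N + 1) * Real.exp (-(u - η) ^ 2 / (2 * S)) + 4 * N * Real.exp (-E)) := by
    refine (measure_mono_ae hsub).trans ((measure_union_le _ _).trans ?_)
    rw [ENNReal.ofReal_add (by positivity) (by positivity)]
    refine add_le_add ?_ ?_
    · refine (measure_biUnion_finset_le _ _).trans ((Finset.sum_le_sum hA0).trans ?_)
      rw [Finset.sum_const, Finset.card_range, nsmul_eq_mul, ENNReal.ofReal_mul (by positivity)]
      gcongr
      rw [← ENNReal.ofReal_natCast]; push_cast; rfl
    · have hB : ∀ i, P (⋃ j ∈ Finset.range (N * 2 ^ (i + 1)), A i j) ≤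
          ENNReal.ofReal (2 * N * Real.exp (-E) * (1 / 2) ^ i) := by
        intro i
        refine (measure_biUnion_finset_le _ _).trans
          ((Finset.sum_le_sum fun j _ => hA i j).trans ?_)
        rw [Finset.sum_const, Finset.card_range, nsmul_eq_mul, ← ENNReal.ofReal_natCast,
          ← ENNReal.ofReal_mul (by positivity)]
        apply ENNReal.ofReal_le_ofReal
        have : ((1 : ℝ) / 4) ^ i = (1 / 2) ^ i * (1 / 2) ^ i := by rw [← mul_pow]; norm_num
        have h2 : (2 : ℝ) ^ i * (1 / 2) ^ i = 1 := by rw [← mul_pow]; norm_num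
        push_cast
        rw [this, pow_succ]
        refine le_of_eq ?_
        calc (N : ℝ) * (2 ^ i * 2) * (Real.exp (-E) * ((1 / 2) ^ i * (1 / 2) ^ i))
            = 2 * N * Real.exp (-E) * (1 / 2) ^ i * (2 ^ i * (1 / 2) ^ i) := by ring
          _ = _ := by rw [h2, mul_one]
      refine (measure_iUnion_le _).trans ((ENNReal.tsum_le_tsum hB).trans ?_)
      rw [← ENNReal.ofReal_tsum_of_nonneg (fun i => by positivity)
        (summable_geometric_two.mul_left _), tsum_mul_left, tsum_geometric_two]
      apply ENNReal.ofReal_le_ofReal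
      linarith
  exact ENNReal.toReal_le_of_le_ofReal (by positivity) hmeas

end Chaining

section Gaussian

/-- Chernoff bound for a centered Gaussian variable whose variance is at most `S`. -/
lemma measureReal_ge_le_of_map_eq_gaussianReal {Ω : Type*} [MeasurableSpace Ω] {P : Measure Ω}
    [IsProbabilityMeasure P] {Y : Ω → ℝ} {v : NNReal} (hY : P.map Y = gaussianReal 0 v) {S : ℝ}
    (hv : (v : ℝ) ≤ S) {x : ℝ} (hx : 0 ≤ x) :
    P.real {ω | x ≤ Y ω} ≤ Real.exp (-x ^ 2 / (2 * S)) := by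
  have hS : 0 ≤ S := v.2.trans hv
  have hYm : AEMeasurable Y P := by
    by_contra h
    rw [Measure.map_of_not_aemeasurable h] at hY
    exact IsProbabilityMeasure.ne_zero (gaussianReal 0 v) hY.symm
  have h : HasSubgaussianMGF Y ⟨S, hS⟩ P :=
    { integrable_exp_mul := fun t => by
        have := integrable_exp_mul_gaussianReal (μ := 0) (v := v) t
        rw [← hY, integrable_map_measure (by fun_prop) hYm] at this
        exact this
      mgf_le := fun t => by
        rw [mgf_gaussianReal hY]
        apply Real.exp_le_exp.2
        simp only [zero_mul, zero_add]
        change (v : ℝ) * t ^ 2 / 2 ≤ S * t ^ 2 / 2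
        gcongr }
  exact h.measure_ge_le hx

/-- Lower bound for the standard normal tail. -/
lemma exp_div_le_stdNormalTail {v : ℝ} (hv : 0 ≤ v) :
    Real.exp (-v ^ 2 / 2) / (Real.exp 3 * (1 + v)) ≤ stdNormalTail v := by
  have hv1 : 0 < 1 + v := by linarith
  have hI : ((gaussianReal 0 1) (Ioi v)).toReal = ∫ x in Ioi v, gaussianPDFReal 0 1 x := by
    rw [gaussianReal_apply_eq_integral _ one_ne_zero, ENNReal.toReal_ofReal]
    exact integral_nonneg fun x => gaussianPDFReal_nonneg _ _ _
  have hmono : ∫ x in Ioc v (v + 1 / (1 + v)), gaussianPDFReal 0 1 x ≤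
      ∫ x in Ioi v, gaussianPDFReal 0 1 x :=
    setIntegral_mono_set (integrable_gaussianPDFReal 0 1).integrableOn
      (Eventually.of_forall fun x => gaussianPDFReal_nonneg _ _ _)
      (Eventually.of_forall Ioc_subset_Ioi_self)
  have hsqrt : Real.sqrt (2 * Real.pi * (1 : NNReal)) ≤ Real.exp (3 / 2) := by
    have h1 : 2 * Real.pi * ((1 : NNReal) : ℝ) ≤ Real.exp (3 / 2) ^ 2 := by
      have h4 : Real.exp (3 / 2) ^ 2 = Real.exp 1 ^ 3 := by
        rw [← Real.exp_nat_mul, ← Real.exp_nat_mul]; norm_num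
      rw [h4]
      calc 2 * Real.pi * ((1 : NNReal) : ℝ) ≤ 2 * 4 := by
            simpa using Real.pi_le_four
        _ ≤ 2.7 ^ 3 := by norm_num
        _ ≤ _ := by gcongr; linarith [Real.exp_one_gt_d9]
    exact Real.sqrt_le_iff.2 ⟨(Real.exp_pos _).le, h1⟩
  have hpdf : ∀ x ∈ Ioc v (v + 1 / (1 + v)),
      Real.exp (-v ^ 2 / 2) / Real.exp 3 ≤ gaussianPDFReal 0 1 x := by
    intro x hx
    have hx0 : 0 ≤ x := hv.trans hx.1.le
    have hw : 1 / (1 + v) ≤ 1 := by rw [div_le_one hv1]; linarith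
    have hvw : v * (1 / (1 + v)) ≤ 1 := by rw [mul_one_div, div_le_one hv1]; linarith
    have hw0 : 0 ≤ 1 / (1 + v) := by positivity
    have hsq : x ^ 2 ≤ v ^ 2 + 3 := by
      have : x ^ 2 ≤ (v + 1 / (1 + v)) ^ 2 := pow_le_pow_left₀ hx0 hx.2 2
      nlinarith
    rw [gaussianPDFReal_def]
    have h1 : Real.exp (-v ^ 2 / 2) / Real.exp 3 =
        (Real.exp (3 / 2))⁻¹ * Real.exp (-(v ^ 2 + 3) / 2) := by
      rw [← Real.exp_sub, ← Real.exp_neg, ← Real.exp_add]; congr 1; ring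
    rw [h1]
    refine mul_le_mul (inv_anti₀ (by positivity) hsqrt) (Real.exp_le_exp.2 ?_)
      (Real.exp_pos _).le (by positivity)
    simp only [sub_zero, NNReal.coe_one, mul_one]
    linarith
  have hlow : Real.exp (-v ^ 2 / 2) / Real.exp 3 * (1 / (1 + v)) ≤
      ∫ x in Ioc v (v + 1 / (1 + v)), gaussianPDFReal 0 1 x := by
    have := setIntegral_ge_of_const_le_real (μ := volume) (measurableSet_Ioc)
      (by simp) hpdf (integrable_gaussianPDFReal 0 1).integrableOn
    refine le_trans (le_of_eq ?_) this
    rw [Real.volume_real_Ioc_of_le (by linarith [one_div_pos.2 hv1])]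
    ring
  calc Real.exp (-v ^ 2 / 2) / (Real.exp 3 * (1 + v))
      = Real.exp (-v ^ 2 / 2) / Real.exp 3 * (1 / (1 + v)) := by field_simp
    _ ≤ _ := by rw [stdNormalTail, hI]; exact hlow.trans hmono

end Gaussian

namespace IsCenteredGaussianCov

variable {Ω : Type*} [MeasurableSpace Ω] {P : Measure Ω} {X : ℝ → Ω → ℝ} {K : ℝ → ℝ → ℝ}

lemma exists_map_eq (h : IsCenteredGaussianCov P X K) {s : ℝ} (hs : 0 ≤ s) :
    ∃ v : NNReal, (v : ℝ) = K s s ∧ P.map (X s) = gaussianReal 0 v := by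
  obtain ⟨v, hv, hm⟩ := h.2 1 (fun _ => s) (fun _ => 1) (fun _ => hs)
  exact ⟨v, by simpa using hv, by simpa using hm⟩

lemma exists_map_sub_eq (h : IsCenteredGaussianCov P X K) {s t : ℝ} (hs : 0 ≤ s) (ht : 0 ≤ t) :
    ∃ v : NNReal, (v : ℝ) = K t t - K t s - K s t + K s s ∧
      P.map (fun ω => X t ω - X s ω) = gaussianReal 0 v := by
  obtain ⟨v, hv, hm⟩ := h.2 2 ![t, s] ![1, -1] (by intro i; fin_cases i <;> simpa)
  refine ⟨v, ?_, ?_⟩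
  · rw [hv]; simp [Fin.sum_univ_two]; ring
  · rw [← hm]; simp [Fin.sum_univ_two, sub_eq_add_neg]

end IsCenteredGaussianCov

/-- A convex function on `[0, ∞)` vanishing at `0` is star-shaped. -/
lemma ConvexOn.le_div_mul_of_map_zero {f : ℝ → ℝ} (hf : ConvexOn ℝ (Ici 0) f) (h0 : f 0 = 0)
    {s t : ℝ} (hs : 0 ≤ s) (hst : s ≤ t) (ht : 0 < t) : f s ≤ s / t * f t := by
  have hst1 : s / t ≤ 1 := (div_le_one ht).2 hst
  have := hf.2 (mem_Ici.2 le_rfl) (mem_Ici.2 ht.le) (sub_nonneg.2 hst1) (by positivity)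
    (sub_add_cancel 1 (s / t))
  simpa [h0, div_mul_cancel₀ _ ht.ne'] using this

/-- A convex function on `[0, ∞)` vanishing at `0` and regularly varying with index less than `2`
is eventually at least `1`, and eventually satisfies the doubling bound with constant `4`. -/
lemma eventually_one_le_and_doubling {f : ℝ → ℝ} {a : ℝ} (ha : a < 2)
    (hf : ConvexOn ℝ (Ici 0) f) (h0 : f 0 = 0) (hpos : ∀ t, 0 ≤ t → 0 ≤ f t)
    (hreg : Tendsto (fun t => f (2 * t) / f t) atTop (nhds ((2 : ℝ) ^ a))) :
    ∀ᶠ t in atTop, 1 ≤ f t ∧ f (2 * t) ≤ 4 * f t := by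
  have h4 : (2 : ℝ) ^ a < 4 := by
    calc (2 : ℝ) ^ a < 2 ^ (2 : ℝ) := Real.rpow_lt_rpow_of_exponent_lt (by norm_num) ha
      _ = 4 := by norm_num
  have hlt := hreg.eventually (gt_mem_nhds h4)
  have hgt := hreg.eventually (lt_mem_nhds (Real.rpow_pos_of_pos two_pos a))
  obtain ⟨t₀, ht₀, ht₀pos⟩ := (hgt.and (eventually_gt_atTop 0)).exists
  have hft₀ : 0 < f t₀ := by
    refine (hpos t₀ ht₀pos.le).lt_of_ne fun h => ?_
    simp [← h] at ht₀
  filter_upwards [hlt, eventually_ge_atTop t₀, eventually_ge_atTop (t₀ / f t₀)] with t h1 h2 h3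
  have ht : 0 < t := ht₀pos.trans_le h2
  have h5 := hf.le_div_mul_of_map_zero h0 ht₀pos.le h2 ht
  have hone : 1 ≤ f t := by
    rw [div_mul_eq_mul_div, le_div_iff₀ ht] at h5
    rw [div_le_iff₀ hft₀] at h3
    nlinarith
  exact ⟨hone, by rw [div_lt_iff₀ (by linarith)] at h1; exact h1.le⟩

/-- Variance reduction on `[0, t - δ(u, t)]`. -/
lemma le_div_of_le_sub_deltaFn {σ2 d : ℝ → ℝ} {u t s : ℝ} (hconv : ConvexOn ℝ (Ici 0) σ2)
    (h0 : σ2 0 = 0) (ht : 0 < t) (hd : HasDerivWithinAt σ2 (d t) (Ici 0) t) (hσ : 0 < σ2 t)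
    (hdbl : σ2 (2 * t) ≤ 4 * σ2 t) (hu : 0 < u) (hs : 0 ≤ s) (hst : s ≤ t - deltaFn σ2 d u t) :
    σ2 s ≤ σ2 t / (1 + 4 / 3 * σ2 t * Real.log u ^ 2 / u ^ 2) := by
  have hdpos : 0 < d t := by
    have := hconv.slope_le_of_hasDerivWithinAt (mem_Ici.2 le_rfl) (mem_Ici.2 ht.le) ht hd
    rw [slope_def_field, h0, sub_zero, sub_zero] at this
    exact (div_pos hσ ht).trans_le this
  have hdle : d t * t ≤ 3 * σ2 t := by
    have := hconv.le_slope_of_hasDerivWithinAt (mem_Ici.2 ht.le)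
      (mem_Ici.2 (by linarith : 0 ≤ 2 * t)) (by linarith) hd
    rw [slope_def_field, le_div_iff₀ (by linarith)] at this
    nlinarith
  set x := 4 / 3 * σ2 t * Real.log u ^ 2 / u ^ 2 with hx
  have hx0 : 0 ≤ x := by positivity
  have hδ : deltaFn σ2 d u t = 3 * x * σ2 t / d t := by
    have h4 : Real.sqrt (σ2 t) ^ 3 * Real.sqrt (σ2 t) = σ2 t ^ 2 := by
      rw [← pow_succ, show 3 + 1 = 2 * 2 from rfl, pow_mul, Real.sq_sqrt hσ.le]
    have hsq : 0 < Real.sqrt (σ2 t) := Real.sqrt_pos.2 hσ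
    calc deltaFn σ2 d u t
        = 4 * (Real.sqrt (σ2 t) ^ 3 * Real.sqrt (σ2 t)) * Real.log u ^ 2 / (d t * u ^ 2) := by
          rw [deltaFn]; field_simp; ring
      _ = _ := by rw [h4, hx]; field_simp
  have hδx : x * t ≤ deltaFn σ2 d u t := by
    rw [hδ, le_div_iff₀ hdpos]
    nlinarith
  have hst' : s ≤ t := by nlinarith
  have hst2 : s / t ≤ 1 - x := by rw [div_le_iff₀ ht]; linarith
  calc σ2 s ≤ s / t * σ2 t := hconv.le_div_mul_of_map_zero h0 hs hst' ht
    _ ≤ (1 - x) * σ2 t := by gcongr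
    _ ≤ σ2 t / (1 + x) := by
      rw [le_div_iff₀ (by linarith)]
      nlinarith [mul_nonneg hσ.le (sq_nonneg x)]

lemma deltaFn_nonneg {σ2 d : ℝ → ℝ} {u t : ℝ} (hd : 0 ≤ d t) : 0 ≤ deltaFn σ2 d u t := by
  rw [deltaFn]; positivity

/-- The final comparison of exponentials for fixed large `u`. -/
lemma chaining_bound_le_stdNormalTail_mul {u v D E N : ℝ} (hv : 1 ≤ v) (hD : 0 < D) (hu : 1 ≤ u)
    (hlog : 48 ≤ Real.log u) (hN0 : 0 ≤ N) (hN : N ≤ 32 * (D + 1) * u ^ 6 + 1)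
    (hE : 2 * u ^ 2 ≤ E)
    (hC : 68 * (D + 1) * (Real.exp 3 + 4) * Real.exp 3 ≤ u) :
    (N + 1) * Real.exp (-(u - u⁻¹) ^ 2 /
        (2 * (v / (1 + 4 / 3 * v * Real.log u ^ 2 / u ^ 2)))) + 4 * N * Real.exp (-E) ≤
      stdNormalTail (u / Real.sqrt v) * Real.exp (-(Real.log u ^ 2) / 2) := by
  have hu0 : 0 < u := by linarith
  have hv0 : 0 < v := by linarith
  set L := Real.log u with hL
  have hLu : L ≤ u := Real.log_le_self hu0.le
  have hL0 : 0 ≤ L := by linarith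
  have hL2 : L ^ 2 ≤ u ^ 2 := pow_le_pow_left₀ hL0 hLu 2
  have hLu1 : L ^ 2 / u ^ 2 ≤ 1 := (div_le_one (by positivity)).2 hL2
  have hv1 : 1 / v ≤ 1 := (div_le_one hv0).2 hv
  have he1 : -(u - u⁻¹) ^ 2 / (2 * (v / (1 + 4 / 3 * v * L ^ 2 / u ^ 2))) ≤
      3 + (-u ^ 2 / (2 * v) - 2 / 3 * L ^ 2) := by
    have h1 : u ^ 2 - 2 ≤ (u - u⁻¹) ^ 2 := by
      have : u * u⁻¹ = 1 := mul_inv_cancel₀ hu0.ne'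
      nlinarith [sq_nonneg u⁻¹]
    have h2 : -(u - u⁻¹) ^ 2 / (2 * (v / (1 + 4 / 3 * v * L ^ 2 / u ^ 2))) =
        -((u - u⁻¹) ^ 2 * ((1 + 4 / 3 * v * L ^ 2 / u ^ 2) / (2 * v))) := by
      field_simp
    have h3 : (u ^ 2 - 2) * ((1 + 4 / 3 * v * L ^ 2 / u ^ 2) / (2 * v)) =
        u ^ 2 / (2 * v) + 2 / 3 * L ^ 2 - 1 / v - 4 / 3 * (L ^ 2 / u ^ 2) := by
      field_simp
      ring
    have h4 := mul_le_mul_of_nonneg_right h1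
      (by positivity : 0 ≤ (1 + 4 / 3 * v * L ^ 2 / u ^ 2) / (2 * v))
    rw [h3] at h4
    rw [h2, neg_div]
    linarith
  have he2 : -E ≤ -u ^ 2 / (2 * v) - 2 / 3 * L ^ 2 := by
    have : u ^ 2 / (2 * v) ≤ u ^ 2 := div_le_self (by positivity) (by linarith)
    rw [neg_div]
    linarith [sq_nonneg L]
  have htail : Real.exp (-u ^ 2 / (2 * v)) / (Real.exp 3 * (2 * u)) ≤
      stdNormalTail (u / Real.sqrt v) := by
    have hs1 : 1 ≤ Real.sqrt v := Real.one_le_sqrt.2 hv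
    have hw : u / Real.sqrt v ≤ u := div_le_self hu0.le hs1
    refine le_trans ?_ (exp_div_le_stdNormalTail (by positivity : 0 ≤ u / Real.sqrt v))
    rw [div_pow, Real.sq_sqrt hv0.le]
    have : -(u ^ 2 / v) / 2 = -u ^ 2 / (2 * v) := by field_simp
    rw [this]
    gcongr
    linarith
  have hpoly : (N + 1) * (Real.exp 3 + 4) * (Real.exp 3 * (2 * u)) ≤ Real.exp (L ^ 2 / 6) := by
    have h6 : 1 ≤ u ^ 6 := one_le_pow₀ hu
    have hN1 : N + 1 ≤ 34 * (D + 1) * u ^ 6 := by nlinarith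
    calc (N + 1) * (Real.exp 3 + 4) * (Real.exp 3 * (2 * u))
        ≤ 34 * (D + 1) * u ^ 6 * (Real.exp 3 + 4) * (Real.exp 3 * (2 * u)) := by gcongr
      _ = 68 * (D + 1) * (Real.exp 3 + 4) * Real.exp 3 * u ^ 7 := by ring
      _ ≤ u * u ^ 7 := by gcongr
      _ = Real.exp L ^ 8 := by rw [hL, Real.exp_log hu0]; ring
      _ = Real.exp (8 * L) := by rw [← Real.exp_nat_mul]; norm_num
      _ ≤ _ := Real.exp_le_exp.2 (by nlinarith)
  set w := -u ^ 2 / (2 * v) with hw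
  calc _ ≤ (N + 1) * (Real.exp 3 * Real.exp (w - 2 / 3 * L ^ 2)) +
        4 * (N + 1) * Real.exp (w - 2 / 3 * L ^ 2) := by
        rw [← Real.exp_add]
        gcongr
        linarith
    _ = (N + 1) * (Real.exp 3 + 4) * (Real.exp 3 * (2 * u)) *
        (Real.exp (w - 2 / 3 * L ^ 2) / (Real.exp 3 * (2 * u))) := by field_simp
    _ ≤ Real.exp (L ^ 2 / 6) * (Real.exp (w - 2 / 3 * L ^ 2) / (Real.exp 3 * (2 * u))) := by
        gcongr
    _ = Real.exp w / (Real.exp 3 * (2 * u)) * Real.exp (-(L ^ 2) / 2) := by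
        have : Real.exp (L ^ 2 / 6) * Real.exp (w - 2 / 3 * L ^ 2) =
            Real.exp w * Real.exp (-(L ^ 2) / 2) := by
          rw [← Real.exp_add, ← Real.exp_add]
          congr 1
          ring
        rw [mul_div_assoc', this, div_mul_eq_mul_div]
    _ ≤ _ := by gcongr

/-- Lemma 6.4: for a centered Gaussian process with stationary increments satisfying
A1–A3, for all sufficiently large `u`, uniformly in `t ∈ [u^{τ₁}, u^{τ₂}]`,
`ℙ(sup_{[0, t-δ]} X > u) ≤ Ψ(u/σ_X(t)) exp(-log²(u)/2)`. -/
theorem sup_cut_bound {Ω : Type*} [MeasurableSpace Ω]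
    (P : Measure Ω) [IsProbabilityMeasure P]
    (X : ℝ → Ω → ℝ) (σ2 : ℝ → ℝ) (αinf : ℝ) (hαinf : αinf ∈ Set.Ioo (1 : ℝ) 2)
    (hGauss : IsCenteredGaussianCov P X
      (fun s t => (σ2 s + σ2 t - σ2 |t - s|) / 2))
    (hpath : ∀ᵐ ω ∂P, ContinuousOn (fun t => X t ω) (Set.Ici 0))
    (hX0 : ∀ᵐ ω ∂P, X 0 ω = 0)
    -- A1 : σ2 ∈ C¹([0,∞)) and σ2 is convex
    (d : ℝ → ℝ) (hdcont : ContinuousOn d (Set.Ici 0))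
    (hderiv : ∀ t ∈ Set.Ici (0 : ℝ), HasDerivWithinAt σ2 (d t) (Set.Ici 0) t)
    (hconv : ConvexOn ℝ (Set.Ici 0) σ2)
    -- A2 : σ2 is regularly varying at ∞ with index αinf
    (hA2 : ∀ l : ℝ, 0 < l →
      Tendsto (fun t => σ2 (l * t) / σ2 t) atTop (nhds (l ^ αinf)))
    -- A3
    (D : ℝ) (hD : 0 < D) (hA3 : ∀ t : ℝ, 0 ≤ t → σ2 t ≤ D * t ^ αinf)
    (α : ℝ) (hα : 0 < α) :
    ∀ᶠ u : ℝ in atTop,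
      ∀ t ∈ Set.Icc (u ^ (2 / (αinf + 2 * α))) (u ^ (4 / (2 * αinf + α))),
        (P {ω | u < sSup ((fun s => X s ω) ''
            Set.Icc 0 (t - deltaFn σ2 d u t))}).toReal ≤
          stdNormalTail (u / Real.sqrt (σ2 t)) *
            Real.exp (-(Real.log u ^ (2 : ℕ)) / 2) := by
  have hσ0 : σ2 0 = 0 := by
    obtain ⟨v, hv, -⟩ := hGauss.exists_map_eq le_rfl
    have h1 := hA3 0 le_rfl
    rw [Real.zero_rpow (by linarith [hαinf.1]), mul_zero] at h1
    simp only [sub_self, abs_zero] at hv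
    linarith [v.2, show (v : ℝ) = v.1 from rfl]
  have hvar : ∀ s, 0 ≤ s → ∃ v : NNReal, (v : ℝ) = σ2 s ∧ P.map (X s) = gaussianReal 0 v := by
    intro s hs
    obtain ⟨v, hv, hm⟩ := hGauss.exists_map_eq hs
    refine ⟨v, ?_, hm⟩
    rw [hv]; simp [hσ0]
  have hσnn : ∀ t, 0 ≤ t → 0 ≤ σ2 t := fun t ht => by
    obtain ⟨v, hv, -⟩ := hvar t ht
    exact hv ▸ v.2
  have hincr : ∀ s t q, 0 ≤ s → s ≤ t → t - s ≤ q → 0 < q → q ≤ 1 → ∀ x, 0 ≤ x →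
      P.real {ω | x ≤ X t ω - X s ω} ≤ Real.exp (-x ^ 2 / (2 * (D * q))) := by
    intro s t q hs hst hq hq0 hq1 x hx
    obtain ⟨v, hv, hm⟩ := hGauss.exists_map_sub_eq hs (hs.trans hst)
    refine measureReal_ge_le_of_map_eq_gaussianReal hm ?_ hx
    have hv' : (v : ℝ) = σ2 (t - s) := by
      rw [hv, abs_sub_comm s t, abs_of_nonneg (sub_nonneg.2 hst)]
      simp [hσ0]
      ring
    calc (v : ℝ) = σ2 (t - s) := hv'
      _ ≤ D * (t - s) ^ αinf := hA3 _ (sub_nonneg.2 hst)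
      _ ≤ D * q ^ αinf := by
        gcongr
        linarith [hαinf.1]
      _ ≤ D * q ^ (1 : ℝ) := by
        gcongr D * ?_
        exact Real.rpow_le_rpow_of_exponent_ge hq0 hq1 hαinf.1.le
      _ = D * q := by rw [Real.rpow_one]
  obtain ⟨T₀, hT₀⟩ := eventually_atTop.1
    ((eventually_one_le_and_doubling hαinf.2 hconv hσ0 hσnn (hA2 2 two_pos)).and
      (eventually_gt_atTop 0))
  have hτ : 0 < 2 / (αinf + 2 * α) := div_pos two_pos (by linarith [hαinf.1])
  filter_upwards [(tendsto_rpow_atTop hτ).eventually_ge_atTop T₀, eventually_ge_atTop 3,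
    Real.tendsto_log_atTop.eventually_ge_atTop 48,
    eventually_ge_atTop (68 * (D + 1) * (Real.exp 3 + 4) * Real.exp 3)] with u hu1 hu3 hlog hC t ht
  obtain ⟨⟨hσ1, hdbl⟩, htpos⟩ := hT₀ t (hu1.trans ht.1)
  have hu0 : 0 < u := by linarith
  have hdpos : 0 ≤ d t := by
    have := hconv.slope_le_of_hasDerivWithinAt (mem_Ici.2 le_rfl) (mem_Ici.2 htpos.le) htpos
      (hderiv t htpos.le)
    rw [slope_def_field, hσ0, sub_zero, sub_zero] at this
    exact le_trans (by positivity) this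
  have htu : t - deltaFn σ2 d u t ≤ u ^ 2 := by
    have h1 : u ^ (4 / (2 * αinf + α)) ≤ u ^ (2 : ℝ) := by
      apply Real.rpow_le_rpow_of_exponent_le (by linarith)
      rw [div_le_iff₀ (by linarith [hαinf.1])]
      linarith [hαinf.1]
    rw [Real.rpow_two] at h1
    linarith [ht.2, deltaFn_nonneg (σ2 := σ2) (u := u) hdpos]
  set r : ℝ := 1 / (32 * (D + 1) * u ^ 4) with hr
  have hr0 : 0 < r := by positivity
  have hu4 : 1 ≤ u ^ 4 := one_le_pow₀ (by linarith)
  have hr1 : r ≤ 1 := by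
    rw [hr, div_le_one (by positivity)]
    nlinarith
  have hN0 : 0 < ⌈u ^ 2 / r⌉₊ := Nat.ceil_pos.2 (by positivity)
  have hE : 2 * u ^ 2 ≤ u⁻¹ ^ 2 / (16 * (D * r)) := by
    have : u⁻¹ ^ 2 / (16 * (D * r)) = 2 * u ^ 2 * ((D + 1) / D) := by
      rw [hr]; field_simp; ring
    rw [this]
    exact le_mul_of_one_le_right (by positivity) ((one_le_div hD).2 (by linarith))
  refine (measureReal_lt_sSup_le P hpath (η := u⁻¹) hu0 (by positivity) ?_ hD hr0 hr1 hN0 ?_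
    (fun s hs x hx => ?_) hincr ?_).trans
      (chaining_bound_le_stdNormalTail_mul hσ1 hD (by linarith) hlog (Nat.cast_nonneg _) ?_ hE hC)
  · exact (inv_le_one_of_one_le₀ (by linarith)).trans (by linarith)
  · exact htu.trans ((div_le_iff₀ hr0).1 (Nat.le_ceil _))
  · obtain ⟨v, hv, hm⟩ := hvar s hs.1
    refine measureReal_ge_le_of_map_eq_gaussianReal hm ?_ hx
    rw [hv]
    exact le_div_of_le_sub_deltaFn hconv hσ0 htpos (hderiv t htpos.le) (by linarith) hdbl hu0
      hs.1 hs.2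
  · nlinarith
  · refine (Nat.ceil_lt_add_one (by positivity)).le.trans (le_of_eq ?_)
    rw [hr]; field_simp
end
end

section
/- Let σ²_X : [0,∞) → [0,∞) be a C¹, convex function with σ²_X(0) = 0 that satisfies σ²_X(t) = D t^{α_∞} + o(t^{α_∞ − α}) as t → ∞ for some α_∞ ∈ (1,2), D > 0 and α > 0, let σ_X be its nonnegative square root, and let T ∈ W(α, β, γ, C) be a nonnegative random variable. Then σ_X(T) ∈ W( 2α/α_∞, β D^{−α/α_∞}, 2γ/α_∞, C D^{−γ/α_∞} ); that is, ℙ( σ_X(T) > u ) = C D^{−γ/α_∞} u^{2γ/α_∞} exp( −(β/D^{α/α_∞}) u^{2α/α_∞} ) (1 + o(1)) as u → ∞. -/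
open MeasureTheory Filter Set Asymptotics

noncomputable section

/-- A convex function on `[0, ∞)` vanishing at `0` is strictly increasing where it is positive. -/
theorem ConvexOn.lt_of_pos_of_lt {f : ℝ → ℝ} (hf : ConvexOn ℝ (Ici 0) f) (hf0 : f 0 = 0)
    {s t : ℝ} (hs : 0 ≤ s) (hst : s < t) (hpos : 0 < f s) : f s < f t := by
  have ht : 0 < t := hs.trans_lt hst
  have hle : f s ≤ s / t * f t := by
    have h := hf.2 (mem_Ici.2 le_rfl) (mem_Ici.2 ht.le)
      (show 0 ≤ 1 - s / t by rw [sub_nonneg, div_le_one ht]; exact hst.le)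
      (show 0 ≤ s / t by positivity) (by ring)
    simpa [hf0, div_mul_cancel₀ s ht.ne'] using h
  have hlt : s / t < 1 := (div_lt_one ht).2 hst
  have hft : 0 < f t := by
    by_contra! hneg
    have : s / t * f t ≤ 0 := mul_nonpos_of_nonneg_of_nonpos (by positivity) hneg
    linarith
  nlinarith

/-- A nonnegative convex function on `[0, ∞)` vanishing at `0` is monotone. -/
theorem ConvexOn.monotoneOn_Ici_of_nonneg {f : ℝ → ℝ} (hf : ConvexOn ℝ (Ici 0) f)
    (hf0 : f 0 = 0) (hnn : ∀ t, 0 ≤ t → 0 ≤ f t) : MonotoneOn f (Ici 0) := by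
  intro s hs t ht hst
  rcases hst.eq_or_lt with rfl | hlt
  · exact le_rfl
  rcases (hnn s hs).eq_or_lt with h | h
  · rw [← h]
    exact hnn t ht
  · exact (hf.lt_of_pos_of_lt hf0 hs hlt h).le

/-- If `x → 0` and `y * x → 0` then `y * ((1 + x) ^ p - 1) → 0`. -/
theorem tendsto_mul_one_add_rpow_sub_one {ι : Type*} {l : Filter ι} {x y : ι → ℝ}
    (hx : Tendsto x l (nhds 0)) (hyx : Tendsto (fun i => y i * x i) l (nhds 0)) (p : ℝ) :
    Tendsto (fun i => y i * ((1 + x i) ^ p - 1)) l (nhds 0) := by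
  have hd : HasDerivAt (fun z : ℝ => (1 + z) ^ p) (p * (1 + 0) ^ (p - 1)) 0 := by
    simpa using ((hasDerivAt_id (0 : ℝ)).const_add 1).rpow_const (p := p) (by simp)
  have hO : (fun z : ℝ => (1 + z) ^ p - 1) =O[nhds 0] fun z => z := by
    simpa using hd.differentiableAt.isBigO_sub
  have h := (isBigO_refl y l).mul (hO.comp_tendsto hx)
  exact h.trans_tendsto hyx

/-- A perturbation of `D * t ^ a` of size `o(t ^ (a - α))` is invisible in the Weibullian tail
with parameters `α, β, γ, C`. -/
theorem tendsto_weibullian_tail_ratio {f : ℝ → ℝ} {a D α β γ C : ℝ} (ha : 0 < a) (hD : 0 < D)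
    (hα : 0 < α) (hC : 0 < C)
    (hf : (fun t : ℝ => f t - D * t ^ a) =o[atTop] fun t : ℝ => t ^ (a - α)) :
    Tendsto (fun t : ℝ => (C * t ^ γ * Real.exp (-β * t ^ α)) /
      (C * D ^ (-γ / a) * f t ^ (γ / a) * Real.exp (-(β * D ^ (-α / a)) * f t ^ (α / a))))
      atTop (nhds 1) := by
  set ε : ℝ → ℝ := fun t => f t / (D * t ^ a) - 1 with hε
  have hαε : Tendsto (fun t => t ^ α * ε t) atTop (nhds 0) := by
    have h := hf.tendsto_div_nhds_zero.div_const D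
    rw [zero_div] at h
    refine h.congr' ?_
    filter_upwards [eventually_gt_atTop 0] with t ht
    have h1 : 0 < t ^ a := Real.rpow_pos_of_pos ht a
    have h2 : 0 < t ^ α := Real.rpow_pos_of_pos ht α
    rw [hε, Real.rpow_sub ht]
    field_simp
  have hε0 : Tendsto ε atTop (nhds 0) := by
    have h := (tendsto_rpow_neg_atTop hα).mul hαε
    rw [zero_mul] at h
    refine h.congr' ?_
    filter_upwards [eventually_gt_atTop 0] with t ht
    rw [← mul_assoc, ← Real.rpow_add ht, neg_add_cancel, Real.rpow_zero, one_mul]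
  have hexp := tendsto_mul_one_add_rpow_sub_one hε0 hαε (α / a)
  have hone : Tendsto (fun t => 1 + ε t) atTop (nhds 1) := by
    simpa using hε0.const_add 1
  have hpow : Tendsto (fun t => (1 + ε t) ^ (-(γ / a))) atTop (nhds 1) := by
    simpa using hone.rpow_const (p := -(γ / a)) (Or.inl one_ne_zero)
  have hlim : Tendsto (fun t => (1 + ε t) ^ (-(γ / a)) *
      Real.exp (β * (t ^ α * ((1 + ε t) ^ (α / a) - 1)))) atTop (nhds 1) := by
    simpa using hpow.mul ((Real.continuous_exp.tendsto _).comp (hexp.const_mul β))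
  refine hlim.congr' ?_
  filter_upwards [eventually_gt_atTop 0, hone.eventually (lt_mem_nhds one_pos)] with t ht h1
  have hta : 0 < t ^ a := Real.rpow_pos_of_pos ht a
  have hft : f t = D * t ^ a * (1 + ε t) := by
    rw [hε]
    field_simp
    ring
  have key : ∀ p : ℝ, D ^ (-p / a) * f t ^ (p / a) = t ^ p * (1 + ε t) ^ (p / a) := by
    intro p
    rw [hft, Real.mul_rpow (by positivity) h1.le, Real.mul_rpow hD.le hta.le, ← Real.rpow_mul ht.le,
      mul_div_cancel₀ p ha.ne', ← mul_assoc, ← mul_assoc, ← Real.rpow_add hD, ← add_div,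
      neg_add_cancel, zero_div, Real.rpow_zero, one_mul]
  have htγ : 0 < t ^ γ := Real.rpow_pos_of_pos ht γ
  have h1γ : 0 < (1 + ε t) ^ (γ / a) := Real.rpow_pos_of_pos h1 _
  have hexponent : -(β * D ^ (-α / a)) * f t ^ (α / a) = -β * (t ^ α * (1 + ε t) ^ (α / a)) := by
    rw [← key]
    ring
  rw [mul_assoc C (D ^ (-γ / a)), key γ, hexponent, Real.rpow_neg h1.le,
    show β * (t ^ α * ((1 + ε t) ^ (α / a) - 1)) =
      -β * t ^ α - -β * (t ^ α * (1 + ε t) ^ (α / a)) by ring, Real.exp_sub]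
  field_simp

/-- If `σ²_X` is a `C¹`, convex, nonnegative function with `σ²_X(0) = 0` and
`σ²_X(t) = D t^{α∞} + o(t^{α∞-α})` as `t → ∞`, and `T ∈ W(α, β, γ, C)`, then
`σ_X(T) ∈ W(2α/α∞, β D^{-α/α∞}, 2γ/α∞, C D^{-γ/α∞})`. -/
theorem sigma_of_weibullian {Ω : Type*} [MeasurableSpace Ω]
    (P : Measure Ω) [IsProbabilityMeasure P]
    (σ2 : ℝ → ℝ) (hσ2nn : ∀ t : ℝ, 0 ≤ t → 0 ≤ σ2 t) (hσ20 : σ2 0 = 0)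
    -- A1 : σ2 ∈ C¹([0,∞)) and σ2 is convex
    (d : ℝ → ℝ) (hdcont : ContinuousOn d (Set.Ici 0))
    (hderiv : ∀ t ∈ Set.Ici (0 : ℝ), HasDerivWithinAt σ2 (d t) (Set.Ici 0) t)
    (hconv : ConvexOn ℝ (Set.Ici 0) σ2)
    -- σ²_X(t) = D t^{αinf} + o(t^{αinf - α}) as t → ∞
    (αinf : ℝ) (hαinf : αinf ∈ Set.Ioo (1 : ℝ) 2)
    (D : ℝ) (hD : 0 < D)
    (α β γ C : ℝ) (hα : 0 < α) (hβ : 0 < β) (hC : 0 < C)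
    (hvar : (fun t : ℝ => σ2 t - D * t ^ αinf) =o[atTop] fun t : ℝ => t ^ (αinf - α))
    -- the Weibullian time T
    (T : Ω → ℝ) (hTm : Measurable T) (hTnn : ∀ ω, 0 ≤ T ω)
    (hTW : MemW P T α β γ C) :
    MemW P (fun ω => Real.sqrt (σ2 (T ω)))
      (2 * α / αinf) (β * D ^ (-α / αinf)) (2 * γ / αinf) (C * D ^ (-γ / αinf)) := by
  have ha : 0 < αinf := one_pos.trans hαinf.1
  have hmono := hconv.monotoneOn_Ici_of_nonneg hσ20 hσ2nn
  have hcont : ContinuousOn σ2 (Ici 0) := fun t ht => (hderiv t ht).continuousWithinAt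
  have hlarge : Tendsto σ2 atTop atTop := by
    have hequiv : σ2 ~[atTop] fun t => D * t ^ αinf := by
      refine hvar.trans_isBigO (IsBigO.of_bound D⁻¹ ?_)
      filter_upwards [eventually_ge_atTop 1] with t ht
      have ht0 : 0 < t := one_pos.trans_le ht
      have hle : t ^ (αinf - α) ≤ t ^ αinf := Real.rpow_le_rpow_of_exponent_le ht (by linarith)
      have hpos : 0 < t ^ αinf := Real.rpow_pos_of_pos ht0 _
      rw [Real.norm_of_nonneg (by positivity), Real.norm_of_nonneg (by positivity),
        inv_mul_cancel_left₀ hD.ne']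
      exact hle
    exact hequiv.symm.tendsto_atTop ((tendsto_rpow_atTop ha).const_mul_atTop hD)
  have hinv : ∀ u : ℝ, ∃ v, 0 ≤ v ∧ σ2 v = u ^ 2 := by
    intro u
    obtain ⟨b, hb, hub⟩ := ((eventually_ge_atTop 0).and
      (hlarge.eventually_ge_atTop (u ^ 2))).exists
    obtain ⟨v, hv, hvu⟩ := intermediate_value_Icc hb (hcont.mono Icc_subset_Ici_self)
      (show u ^ 2 ∈ Icc (σ2 0) (σ2 b) from ⟨by rw [hσ20]; positivity, hub⟩)
    exact ⟨v, hv.1, hvu⟩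
  choose v hv0 hv using hinv
  have hvtop : Tendsto v atTop atTop := by
    refine tendsto_atTop.2 fun M => ?_
    filter_upwards [(tendsto_pow_atTop two_ne_zero).eventually_gt_atTop (σ2 (max M 0))] with u hu
    by_contra! hlt
    have := hmono (hv0 u) (mem_Ici.2 (le_max_right M 0)) (hlt.le.trans (le_max_left M 0))
    rw [hv u] at this
    exact absurd hu this.not_gt
  have hratio := tendsto_weibullian_tail_ratio (β := β) (γ := γ) ha hD hα hC hvar
  have hprod := (hTW.comp hvtop).mul (hratio.comp hvtop)
  rw [one_mul] at hprod
  refine hprod.congr' ?_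
  filter_upwards [eventually_gt_atTop 0, hvtop.eventually_gt_atTop 0] with u hu hvu
  have hset : {ω | u < Real.sqrt (σ2 (T ω))} = {ω | v u < T ω} := by
    ext ω
    rw [mem_ofPred_eq, mem_ofPred_eq, Real.lt_sqrt hu.le, ← hv u]
    refine ⟨fun h => ?_, fun h => hconv.lt_of_pos_of_lt hσ20 (hv0 u) h (by rw [hv u]; positivity)⟩
    by_contra! hle
    exact absurd h (hmono (hTnn ω) (hv0 u) hle).not_gt
  have hpow : ∀ p : ℝ, σ2 (v u) ^ (p / αinf) = u ^ (2 * p / αinf) := by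
    intro p
    rw [hv u, ← Real.rpow_natCast, ← Real.rpow_mul hu.le, mul_div_assoc]
    norm_num
  have hden : C * v u ^ γ * Real.exp (-β * v u ^ α) ≠ 0 :=
    (mul_pos (mul_pos hC (Real.rpow_pos_of_pos hvu γ)) (Real.exp_pos _)).ne'
  simp only [Function.comp_apply, hset, hpow]
  exact div_mul_div_cancel₀ hden
end
end
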